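/- arXiv:2509.06532 — 9 statements merged into one kernel-verified Lean document; each statement's English description precedes it below -/
import Mathlib

section
/- Let t_1 < t_2 < ... < t_n be real numbers (n ≥ 3) with data values f_1, ..., f_n ∈ ℝ. For each i = 1, ..., n−1 let L_i : [t_1, t_n] → [t_i, t_{i+1}] be a homeomorphism with L_i(t_1) = t_i, L_i(t_n) = t_{i+1}, and let F_i : [t_1, t_n] × ℝ → ℝ be continuous with |F_i(t, f) − F_i(t, f*)| ≤ |λ_i| |f − f*| for all t ∈ [t_1, t_n] and f, f* ∈ ℝ, where |λ_i| < 1, and with F_i(t_1, f_1) = f_i and F_i(t_n, f_n) = f_{i+1}. Let C_* denote the set of continuous functions h : [t_1, t_n] → ℝ with h(t_1) = f_1 and h(t_n) = f_n. Then the Read–Bajraktarević operator T, defined for h ∈ C_* by (Th)(s) = F_i(L_i^{-1}(s), h(L_i^{-1}(s))) for s ∈ [t_i, t_{i+1}], is well defined (i.e., Th is continuous and belongs to C_*), and satisfies ‖Th − Tg‖_∞ ≤ (max_{1≤i≤n−1} |λ_i|) ‖h − g‖_∞ for all h, g ∈ C_*. -/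
open Set

/-- Continuous functions on consecutive intervals that take prescribed values at the knots
glue to a continuous function. -/
theorem exists_continuousOn_eqOn_of_knots (t y : ℕ → ℝ) (G : ℕ → ℝ → ℝ) (m : ℕ)
    (ht : ∀ i < m, t i ≤ t (i + 1))
    (hG : ∀ i < m, ContinuousOn (G i) (Icc (t i) (t (i + 1))))
    (hl : ∀ i < m, G i (t i) = y i) (hr : ∀ i < m, G i (t (i + 1)) = y (i + 1)) :
    t 0 ≤ t m ∧ ∃ Φ : ℝ → ℝ, ContinuousOn Φ (Icc (t 0) (t m)) ∧ Φ (t m) = y m ∧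
      ∀ i < m, t (i + 1) ≤ t m ∧ EqOn Φ (G i) (Icc (t i) (t (i + 1))) := by
  induction m with
  | zero => exact ⟨le_rfl, fun _ => y 0, continuousOn_const, rfl, by simp⟩
  | succ m ih =>
    obtain ⟨h0, Φ, hc, hy, he⟩ := ih (fun i hi => ht i (by omega)) (fun i hi => hG i (by omega))
      (fun i hi => hl i (by omega)) (fun i hi => hr i (by omega))
    have hm := ht m (by omega)
    have hleft : EqOn (fun x => if x ≤ t m then Φ x else G m x) Φ (Iic (t m)) :=
      fun x hx => if_pos hx
    have hright : EqOn (fun x => if x ≤ t m then Φ x else G m x) (G m)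
        (Icc (t m) (t (m + 1))) := by
      intro x hx
      rcases hx.1.eq_or_lt with rfl | hlt
      · simp [hy, hl m (by omega)]
      · exact if_neg hlt.not_ge
    refine ⟨h0.trans hm, fun x => if x ≤ t m then Φ x else G m x, ?_, ?_, ?_⟩
    · rw [← Icc_union_Icc_eq_Icc h0 hm]
      exact (hc.congr (hleft.mono Icc_subset_Iic_self)).union_of_isClosed
        ((hG m (by omega)).congr hright) isClosed_Icc isClosed_Icc
    · exact (hright ⟨hm, le_rfl⟩).trans (hr m (by omega))
    · intro i hi
      rcases Nat.lt_succ_iff_lt_or_eq.mp hi with hi | rfl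
      · exact ⟨(he i hi).1.trans hm,
          (hleft.mono fun x hx => hx.2.trans (he i hi).1).trans (he i hi).2⟩
      · exact ⟨le_rfl, hright⟩

/-- Every point between the first and the last knot lies between two consecutive knots. -/
theorem exists_mem_Icc_knots (t : ℕ → ℝ) (m : ℕ) (hm : 0 < m) {s : ℝ}
    (hs : s ∈ Icc (t 0) (t m)) : ∃ i < m, s ∈ Icc (t i) (t (i + 1)) := by
  induction m, hm using Nat.le_induction with
  | base => exact ⟨0, by omega, hs⟩
  | succ m _ ih =>
    rcases le_total s (t m) with h | h
    · obtain ⟨i, hi, his⟩ := ih ⟨hs.1, h⟩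
      exact ⟨i, by omega, his⟩
    · exact ⟨m, by omega, h, hs.2⟩

/-- The Read–Bajraktarević operator `T` is well defined on the set
`C_*` of continuous functions on `[t 1, t n]` with prescribed endpoint values
(`Th` is continuous, has the right endpoint values, and is given piecewise by the
formula), and `T` is a contraction with ratio `max_i |λ i|` for the sup norm. -/
theorem read_bajraktarevic_operator_well_defined_and_contractive
    (n : ℕ) (hn : 3 ≤ n)
    (t f : ℕ → ℝ)
    (ht : ∀ i, 1 ≤ i → i ≤ n - 1 → t i < t (i + 1))
    (lam : ℕ → ℝ)
    (hlam : ∀ i, 1 ≤ i → i ≤ n - 1 → |lam i| < 1)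
    (L Linv : ℕ → ℝ → ℝ)
    -- each `L i` is a homeomorphism of `[t 1, t n]` onto `[t i, t (i+1)]`,
    -- with inverse `Linv i`
    (hLcont : ∀ i, 1 ≤ i → i ≤ n - 1 → ContinuousOn (L i) (Icc (t 1) (t n)))
    (hLinvcont : ∀ i, 1 ≤ i → i ≤ n - 1 →
      ContinuousOn (Linv i) (Icc (t i) (t (i + 1))))
    (hLmaps : ∀ i, 1 ≤ i → i ≤ n - 1 →
      MapsTo (L i) (Icc (t 1) (t n)) (Icc (t i) (t (i + 1))))
    (hLinvmaps : ∀ i, 1 ≤ i → i ≤ n - 1 →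
      MapsTo (Linv i) (Icc (t i) (t (i + 1))) (Icc (t 1) (t n)))
    (hLinvL : ∀ i, 1 ≤ i → i ≤ n - 1 → ∀ x ∈ Icc (t 1) (t n), Linv i (L i x) = x)
    (hLLinv : ∀ i, 1 ≤ i → i ≤ n - 1 → ∀ s ∈ Icc (t i) (t (i + 1)), L i (Linv i s) = s)
    (hL1 : ∀ i, 1 ≤ i → i ≤ n - 1 → L i (t 1) = t i)
    (hLn : ∀ i, 1 ≤ i → i ≤ n - 1 → L i (t n) = t (i + 1))
    (F : ℕ → ℝ → ℝ → ℝ)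
    (hFcont : ∀ i, 1 ≤ i → i ≤ n - 1 →
      ContinuousOn (fun p : ℝ × ℝ => F i p.1 p.2) (Icc (t 1) (t n) ×ˢ (univ : Set ℝ)))
    (hFlip : ∀ i, 1 ≤ i → i ≤ n - 1 → ∀ x ∈ Icc (t 1) (t n), ∀ y y' : ℝ,
      |F i x y - F i x y'| ≤ |lam i| * |y - y'|)
    (hF1 : ∀ i, 1 ≤ i → i ≤ n - 1 → F i (t 1) (f 1) = f i)
    (hFn : ∀ i, 1 ≤ i → i ≤ n - 1 → F i (t n) (f n) = f (i + 1)) :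
    -- (1) well-definedness: for every `h ∈ C_*` there is a function `Th ∈ C_*`
    -- given piecewise by the Read–Bajraktarević formula
    (∀ h : ℝ → ℝ,
      ContinuousOn h (Icc (t 1) (t n)) → h (t 1) = f 1 → h (t n) = f n →
      ∃ Th : ℝ → ℝ,
        ContinuousOn Th (Icc (t 1) (t n)) ∧ Th (t 1) = f 1 ∧ Th (t n) = f n ∧
        ∀ i, 1 ≤ i → i ≤ n - 1 → ∀ s ∈ Icc (t i) (t (i + 1)),
          Th s = F i (Linv i s) (h (Linv i s))) ∧
    -- (2) contraction: `‖Th − Tg‖_∞ ≤ (max_i |λ i|) ‖h − g‖_∞`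
    (∀ h g Th Tg : ℝ → ℝ,
      ContinuousOn h (Icc (t 1) (t n)) → h (t 1) = f 1 → h (t n) = f n →
      ContinuousOn g (Icc (t 1) (t n)) → g (t 1) = f 1 → g (t n) = f n →
      (∀ i, 1 ≤ i → i ≤ n - 1 → ∀ s ∈ Icc (t i) (t (i + 1)),
        Th s = F i (Linv i s) (h (Linv i s))) →
      (∀ i, 1 ≤ i → i ≤ n - 1 → ∀ s ∈ Icc (t i) (t (i + 1)),
        Tg s = F i (Linv i s) (g (Linv i s))) →
      sSup ((fun x => |Th x - Tg x|) '' Icc (t 1) (t n)) ≤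
        ((Finset.Icc 1 (n - 1)).sup' (Finset.nonempty_Icc.mpr (by omega))
            (fun i => |lam i|)) *
          sSup ((fun x => |h x - g x|) '' Icc (t 1) (t n))) := by
  have hn1 : n - 1 + 1 = n := by omega
  have hmem : t 1 ≤ t n := by
    have hmono := (exists_continuousOn_eqOn_of_knots (fun i => t (i + 1)) (fun _ => 0)
      (fun _ _ => 0) (n - 1) (fun i hi => (ht (i + 1) (by omega) (by omega)).le)
      (fun _ _ => continuousOn_const) (fun _ _ => rfl) (fun _ _ => rfl)).1
    simpa only [hn1, zero_add] using hmono
  have h1 : t 1 ∈ Icc (t 1) (t n) := left_mem_Icc.mpr hmem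
  have hN : t n ∈ Icc (t 1) (t n) := right_mem_Icc.mpr hmem
  have hinv1 : ∀ i, 1 ≤ i → i ≤ n - 1 → Linv i (t i) = t 1 := fun i hi hi' => by
    rw [← hL1 i hi hi', hLinvL i hi hi' _ h1]
  have hinvn : ∀ i, 1 ≤ i → i ≤ n - 1 → Linv i (t (i + 1)) = t n := fun i hi hi' => by
    rw [← hLn i hi hi', hLinvL i hi hi' _ hN]
  constructor
  · intro h hh hh1 hhn
    obtain ⟨-, Φ, hc, hy, he⟩ := exists_continuousOn_eqOn_of_knots (fun i => t (i + 1))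
      (fun i => f (i + 1)) (fun i s => F (i + 1) (Linv (i + 1) s) (h (Linv (i + 1) s))) (n - 1)
      (fun i hi => (ht (i + 1) (by omega) (by omega)).le)
      (fun i hi => by
        have hL := hLinvcont (i + 1) (by omega) (by omega)
        have hM := hLinvmaps (i + 1) (by omega) (by omega)
        exact (hFcont (i + 1) (by omega) (by omega)).comp (hL.prodMk (hh.comp hL hM))
          fun s hs => ⟨hM hs, mem_univ _⟩)
      (fun i hi => by
        simp only [hinv1 (i + 1) (by omega) (by omega), hh1, hF1 (i + 1) (by omega) (by omega)])
      (fun i hi => by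
        simp only [hinvn (i + 1) (by omega) (by omega), hhn, hFn (i + 1) (by omega) (by omega)])
    simp only [hn1, zero_add] at hc hy
    have hpiece : ∀ i, 1 ≤ i → i ≤ n - 1 → ∀ s ∈ Icc (t i) (t (i + 1)),
        Φ s = F i (Linv i s) (h (Linv i s)) := by
      intro i hi hi' s hs
      obtain ⟨j, rfl⟩ := Nat.exists_eq_add_of_le' hi
      exact (he j (by omega)).2 hs
    refine ⟨Φ, hc, ?_, hy, hpiece⟩
    rw [hpiece 1 le_rfl (by omega) _ (left_mem_Icc.mpr (ht 1 le_rfl (by omega)).le),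
      hinv1 1 le_rfl (by omega), hh1, hF1 1 le_rfl (by omega)]
  · intro h g Th Tg hh _ _ hg _ _ hTh hTg
    refine csSup_le (Set.Nonempty.image _ ⟨_, h1⟩) ?_
    rintro _ ⟨s, hs, rfl⟩
    obtain ⟨j, hj, hjs⟩ := exists_mem_Icc_knots (fun i => t (i + 1)) (n - 1) (by omega)
      (s := s) (by simpa only [hn1, zero_add] using hs)
    have hj1 : 1 ≤ j + 1 := by omega
    have hjn : j + 1 ≤ n - 1 := by omega
    have hx := hLinvmaps (j + 1) hj1 hjn hjs
    have hbdd : BddAbove ((fun x => |h x - g x|) '' Icc (t 1) (t n)) :=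
      isCompact_Icc.bddAbove_image (hh.sub hg).abs
    have hle := Finset.le_sup' (fun i => |lam i|) (Finset.mem_Icc.mpr ⟨hj1, hjn⟩)
    simp only [hTh (j + 1) hj1 hjn s hjs, hTg (j + 1) hj1 hjn s hjs]
    exact (hFlip (j + 1) hj1 hjn _ hx _ _).trans
      (mul_le_mul hle (le_csSup hbdd (mem_image_of_mem _ hx)) (abs_nonneg _)
        ((abs_nonneg _).trans hle))
end

section
/- Let t_1 < t_2 < ... < t_n be real numbers (n ≥ 3) with data values f_1, ..., f_n ∈ ℝ. For each i = 1, ..., n−1 let L_i : [t_1, t_n] → [t_i, t_{i+1}] be a homeomorphism with L_i(t_1) = t_i, L_i(t_n) = t_{i+1}, and let F_i : [t_1, t_n] × ℝ → ℝ be continuous with |F_i(t, f) − F_i(t, f*)| ≤ |λ_i| |f − f*| for all t ∈ [t_1, t_n] and f, f* ∈ ℝ, where |λ_i| < 1, and with F_i(t_1, f_1) = f_i and F_i(t_n, f_n) = f_{i+1}. Then there exists a unique continuous function h* : [t_1, t_n] → ℝ with h*(t_1) = f_1 and h*(t_n) = f_n satisfying the self-referential equations h*(L_i(t)) = F_i(t,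 h*(t)) for all t ∈ [t_1, t_n] and all i = 1, ..., n−1; moreover this function interpolates the data, i.e., h*(t_j) = f_j for every j = 1, ..., n. -/
open Set

theorem monotone_nodes {t : ℕ → ℝ} {m : ℕ}
    (ht : ∀ i, 1 ≤ i → i < m → t i ≤ t (i + 1)) {i j : ℕ}
    (hi : 1 ≤ i) (hij : i ≤ j) (hj : j ≤ m) : t i ≤ t j := by
  induction j, hij using Nat.le_induction with
  | base => exact le_rfl
  | succ k hk ih => exact (ih (by omega)).trans (ht k (by omega) (by omega))

theorem exists_mem_Icc_nodes {t : ℕ → ℝ} {m : ℕ} (hm : 2 ≤ m) {x : ℝ}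
    (hx : x ∈ Icc (t 1) (t m)) :
    ∃ i, 1 ≤ i ∧ i < m ∧ x ∈ Icc (t i) (t (i + 1)) := by
  induction m, hm using Nat.le_induction with
  | base => exact ⟨1, le_rfl, by norm_num, hx⟩
  | succ k hk ih =>
    rcases le_total x (t k) with h | h
    · obtain ⟨i, h1, h2, h3⟩ := ih ⟨hx.1, h⟩
      exact ⟨i, h1, by omega, h3⟩
    · exact ⟨k, by omega, by omega, h, hx.2⟩

/-- Continuous pieces on consecutive intervals that agree at the nodes glue together. -/
theorem exists_continuousOn_glue {t f : ℕ → ℝ} {G : ℕ → ℝ → ℝ} {m : ℕ} (hm : 1 ≤ m)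
    (ht : ∀ i, 1 ≤ i → i < m → t i ≤ t (i + 1))
    (hG : ∀ i, 1 ≤ i → i < m → ContinuousOn (G i) (Icc (t i) (t (i + 1))))
    (hleft : ∀ i, 1 ≤ i → i < m → G i (t i) = f i)
    (hright : ∀ i, 1 ≤ i → i < m → G i (t (i + 1)) = f (i + 1)) :
    ∃ H : ℝ → ℝ, ContinuousOn H (Icc (t 1) (t m)) ∧ H (t m) = f m ∧
      ∀ i, 1 ≤ i → i < m → EqOn H (G i) (Icc (t i) (t (i + 1))) := by
  induction m, hm using Nat.le_induction with
  | base => exact ⟨fun _ => f 1, continuousOn_const, rfl, fun i _ _ => by omega⟩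
  | succ k hk ih =>
    obtain ⟨H, hHc, hHk, hH⟩ := ih (fun i h1 h2 => ht i h1 (by omega))
      (fun i h1 h2 => hG i h1 (by omega)) (fun i h1 h2 => hleft i h1 (by omega))
      (fun i h1 h2 => hright i h1 (by omega))
    have hmono := monotone_nodes ht le_rfl hk k.le_succ
    have htk := ht k hk k.lt_succ_self
    set H' : ℝ → ℝ := fun x => if x ≤ t k then H x else G k x
    have hlow : ∀ x, x ≤ t k → H' x = H x := fun x hx => if_pos hx
    have hhigh : EqOn H' (G k) (Icc (t k) (t (k + 1))) := by
      intro x hx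
      rcases hx.1.eq_or_lt with rfl | h
      · rw [hlow _ le_rfl, hHk, hleft k hk k.lt_succ_self]
      · exact if_neg h.not_ge
    refine ⟨H', ?_, ?_, ?_⟩
    · rw [← Icc_union_Icc_eq_Icc hmono htk]
      exact (hHc.congr fun x hx => hlow x hx.2).union_of_isClosed
        ((hG k hk k.lt_succ_self).congr hhigh) isClosed_Icc isClosed_Icc
    · rw [hhigh ⟨htk, le_rfl⟩, hright k hk k.lt_succ_self]
    · intro i h1 h2
      rcases (Nat.lt_succ_iff.mp h2).eq_or_lt with rfl | h
      · exact hhigh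
      · intro x hx
        have hik := monotone_nodes ht (by omega : 1 ≤ i + 1) h k.le_succ
        rw [hlow x (hx.2.trans hik)]
        exact hH i h1 h hx

theorem exists_nnreal_bound_lt_one {lam : ℕ → ℝ} {m : ℕ}
    (hlam : ∀ i, 1 ≤ i → i ≤ m → |lam i| < 1) :
    ∃ K : NNReal, K < 1 ∧ ∀ i, 1 ≤ i → i ≤ m → |lam i| ≤ K := by
  refine ⟨(Finset.Icc 1 m).sup fun i => ‖lam i‖₊, ?_, fun i h1 h2 => ?_⟩
  · rw [Finset.sup_lt_iff (by simp)]
    intro i hi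
    rw [Finset.mem_Icc] at hi
    exact_mod_cast hlam i hi.1 hi.2
  · have h := Finset.le_sup (f := fun i => ‖lam i‖₊) (Finset.mem_Icc.mpr ⟨h1, h2⟩)
    exact_mod_cast h

/-- Continuous functions on `[a, b]` with prescribed endpoint values. -/
abbrev EndpointMaps {a b : ℝ} (hab : a ≤ b) (u v : ℝ) :=
  {h : C(Icc a b, ℝ) // h ⟨a, left_mem_Icc.mpr hab⟩ = u ∧ h ⟨b, right_mem_Icc.mpr hab⟩ = v}

theorem isClosed_endpointMaps {a b : ℝ} (hab : a ≤ b) (u v : ℝ) :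
    IsClosed {h : C(Icc a b, ℝ) |
      h ⟨a, left_mem_Icc.mpr hab⟩ = u ∧ h ⟨b, right_mem_Icc.mpr hab⟩ = v} :=
  (isClosed_eq (continuous_eval_const _) continuous_const).inter
    (isClosed_eq (continuous_eval_const _) continuous_const)

theorem nonempty_endpointMaps {a b : ℝ} (hab : a < b) (u v : ℝ) :
    Nonempty (EndpointMaps hab.le u v) := by
  have h : b - a ≠ 0 := sub_ne_zero.mpr hab.ne'
  exact ⟨⟨⟨fun x => u + (x - a) / (b - a) * (v - u), by fun_prop⟩, by simp, by simp [h]⟩⟩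

/-- Existence and uniqueness of the fractal interpolation function:
there is a unique continuous function `h*` on `[t 1, t n]` with the prescribed
endpoint values satisfying the self-referential equations
`h* (L i x) = F i x (h* x)`, and it interpolates all the data. -/
theorem fractal_interpolation_function_exists_unique
    (n : ℕ) (hn : 3 ≤ n)
    (t f : ℕ → ℝ)
    (ht : ∀ i, 1 ≤ i → i ≤ n - 1 → t i < t (i + 1))
    (lam : ℕ → ℝ)
    (hlam : ∀ i, 1 ≤ i → i ≤ n - 1 → |lam i| < 1)
    (L Linv : ℕ → ℝ → ℝ)
    -- each `L i` is a homeomorphism of `[t 1, t n]` onto `[t i, t (i+1)]`,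
    -- with inverse `Linv i`
    (hLcont : ∀ i, 1 ≤ i → i ≤ n - 1 → ContinuousOn (L i) (Icc (t 1) (t n)))
    (hLinvcont : ∀ i, 1 ≤ i → i ≤ n - 1 →
      ContinuousOn (Linv i) (Icc (t i) (t (i + 1))))
    (hLmaps : ∀ i, 1 ≤ i → i ≤ n - 1 →
      MapsTo (L i) (Icc (t 1) (t n)) (Icc (t i) (t (i + 1))))
    (hLinvmaps : ∀ i, 1 ≤ i → i ≤ n - 1 →
      MapsTo (Linv i) (Icc (t i) (t (i + 1))) (Icc (t 1) (t n)))
    (hLinvL : ∀ i, 1 ≤ i → i ≤ n - 1 → ∀ x ∈ Icc (t 1) (t n), Linv i (L i x) = x)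
    (hLLinv : ∀ i, 1 ≤ i → i ≤ n - 1 → ∀ s ∈ Icc (t i) (t (i + 1)), L i (Linv i s) = s)
    (hL1 : ∀ i, 1 ≤ i → i ≤ n - 1 → L i (t 1) = t i)
    (hLn : ∀ i, 1 ≤ i → i ≤ n - 1 → L i (t n) = t (i + 1))
    (F : ℕ → ℝ → ℝ → ℝ)
    (hFcont : ∀ i, 1 ≤ i → i ≤ n - 1 →
      ContinuousOn (fun p : ℝ × ℝ => F i p.1 p.2) (Icc (t 1) (t n) ×ˢ (univ : Set ℝ)))
    (hFlip : ∀ i, 1 ≤ i → i ≤ n - 1 → ∀ x ∈ Icc (t 1) (t n), ∀ y y' : ℝ,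
      |F i x y - F i x y'| ≤ |lam i| * |y - y'|)
    (hF1 : ∀ i, 1 ≤ i → i ≤ n - 1 → F i (t 1) (f 1) = f i)
    (hFn : ∀ i, 1 ≤ i → i ≤ n - 1 → F i (t n) (f n) = f (i + 1)) :
    ∃ hstar : ℝ → ℝ,
      (ContinuousOn hstar (Icc (t 1) (t n)) ∧
        hstar (t 1) = f 1 ∧ hstar (t n) = f n ∧
        ∀ i, 1 ≤ i → i ≤ n - 1 → ∀ x ∈ Icc (t 1) (t n),
          hstar (L i x) = F i x (hstar x)) ∧
      -- uniqueness (as functions on `[t 1, t n]`)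
      (∀ g : ℝ → ℝ,
        (ContinuousOn g (Icc (t 1) (t n)) ∧
          g (t 1) = f 1 ∧ g (t n) = f n ∧
          ∀ i, 1 ≤ i → i ≤ n - 1 → ∀ x ∈ Icc (t 1) (t n),
            g (L i x) = F i x (g x)) →
        EqOn g hstar (Icc (t 1) (t n))) ∧
      -- interpolation of the data
      (∀ j, 1 ≤ j → j ≤ n → hstar (t j) = f j) := by
  have hle : ∀ {i}, i < n → i ≤ n - 1 := by omega
  have htle : ∀ i, 1 ≤ i → i < n → t i ≤ t (i + 1) := fun i h1 h2 => (ht i h1 (hle h2)).le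
  have hab : t 1 < t n := (ht 1 le_rfl (by omega)).trans_le
    (monotone_nodes htle (by norm_num) (by omega) le_rfl)
  have hsub : ∀ i, 1 ≤ i → i < n → Icc (t i) (t (i + 1)) ⊆ Icc (t 1) (t n) := fun i h1 h2 =>
    Icc_subset_Icc (monotone_nodes htle le_rfl h1 h2.le)
      (monotone_nodes htle (by omega) (by omega) le_rfl)
  have ha : t 1 ∈ Icc (t 1) (t n) := left_mem_Icc.mpr hab.le
  have hb : t n ∈ Icc (t 1) (t n) := right_mem_Icc.mpr hab.le
  obtain ⟨K, hK1, hK⟩ := exists_nnreal_bound_lt_one hlam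
  let X := EndpointMaps hab.le (f 1) (f n)
  have : CompleteSpace X := (isClosed_endpointMaps hab.le (f 1) (f n)).completeSpace_coe
  have : Nonempty X := nonempty_endpointMaps hab _ _
  have hLinv1 : ∀ i, 1 ≤ i → i ≤ n - 1 → Linv i (t i) = t 1 := fun i h1 h2 => by
    rw [← hL1 i h1 h2, hLinvL i h1 h2 _ ha]
  have hLinvn : ∀ i, 1 ≤ i → i ≤ n - 1 → Linv i (t (i + 1)) = t n := fun i h1 h2 => by
    rw [← hLn i h1 h2, hLinvL i h1 h2 _ hb]
  -- the Read–Bajraktarević operator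
  have hT : ∀ h : X, ∃ h' : X, ∀ i, 1 ≤ i → i ≤ n - 1 → ∀ s : Icc (t 1) (t n),
      (s : ℝ) ∈ Icc (t i) (t (i + 1)) →
      h'.1 s = F i (Linv i s) (IccExtend hab.le h.1 (Linv i s)) := by
    intro h
    have hext1 : IccExtend hab.le h.1 (t 1) = f 1 := by
      rw [IccExtend_of_mem _ _ ha]; exact h.2.1
    have hextn : IccExtend hab.le h.1 (t n) = f n := by
      rw [IccExtend_of_mem _ _ hb]; exact h.2.2
    have hleft : ∀ i, 1 ≤ i → i < n →
        F i (Linv i (t i)) (IccExtend hab.le h.1 (Linv i (t i))) = f i := fun i h1 h2 => by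
      rw [hLinv1 i h1 (hle h2), hext1, hF1 i h1 (hle h2)]
    obtain ⟨H, hHc, hHn, hH⟩ := exists_continuousOn_glue
      (G := fun i s => F i (Linv i s) (IccExtend hab.le h.1 (Linv i s))) (f := f)
      (by omega : 1 ≤ n) htle
      (fun i h1 h2 => by
        have hc := hLinvcont i h1 (hle h2)
        exact (hFcont i h1 (hle h2)).comp
          (hc.prodMk (h.1.continuous.Icc_extend'.comp_continuousOn hc))
          fun s hs => ⟨hLinvmaps i h1 (hle h2) hs, mem_univ _⟩)
      hleft
      (fun i h1 h2 => by
        simp only [hLinvn i h1 (hle h2), hextn, hFn i h1 (hle h2)])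
    refine ⟨⟨⟨(Icc (t 1) (t n)).domRestrict H, hHc.domRestrict⟩, ?_, hHn⟩,
      fun i h1 h2 s hs => hH i h1 (by omega) hs⟩
    exact (hH 1 le_rfl (by omega) ⟨le_rfl, htle 1 le_rfl (by omega)⟩).trans
      (hleft 1 le_rfl (by omega))
  choose T hT using hT
  have hTK : ContractingWith K T := by
    refine ⟨hK1, LipschitzWith.of_dist_le_mul fun g h => ?_⟩
    rw [Subtype.dist_eq, Subtype.dist_eq, ContinuousMap.dist_le (by positivity)]
    intro s
    obtain ⟨i, h1, h2, hs⟩ := exists_mem_Icc_nodes (by omega) s.2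
    have hmem := hLinvmaps i h1 (hle h2) hs
    rw [hT g i h1 (hle h2) s hs, hT h i h1 (hle h2) s hs, Real.dist_eq]
    refine (hFlip i h1 (hle h2) _ hmem _ _).trans
      (mul_le_mul (hK i h1 (hle h2)) ?_ (abs_nonneg _) K.2)
    rw [IccExtend_of_mem _ _ hmem, IccExtend_of_mem _ _ hmem, ← Real.dist_eq]
    exact ContinuousMap.dist_apply_le_dist _
  set p : X := ContractingWith.fixedPoint T hTK
  have hTp : T p = p := hTK.fixedPoint_isFixedPt
  have hval : ∀ x (hx : x ∈ Icc (t 1) (t n)), IccExtend hab.le p.1 x = p.1 ⟨x, hx⟩ :=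
    fun x hx => IccExtend_of_mem _ _ hx
  have hp1 : IccExtend hab.le p.1 (t 1) = f 1 := (hval _ ha).trans p.2.1
  have hpn : IccExtend hab.le p.1 (t n) = f n := (hval _ hb).trans p.2.2
  have heq : ∀ i, 1 ≤ i → i ≤ n - 1 → ∀ x ∈ Icc (t 1) (t n),
      IccExtend hab.le p.1 (L i x) = F i x (IccExtend hab.le p.1 x) := by
    intro i h1 h2 x hx
    have hLx := hLmaps i h1 h2 hx
    rw [hval _ (hsub i h1 (by omega) hLx), ← hTp, hT p i h1 h2 _ hLx, hTp,
      hLinvL i h1 h2 x hx]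
  refine ⟨IccExtend hab.le p.1, ⟨p.1.continuous.Icc_extend'.continuousOn, hp1, hpn, heq⟩, ?_, ?_⟩
  · rintro g ⟨hgc, hg1, hgn, hg⟩ x hx
    let q : X := ⟨⟨(Icc (t 1) (t n)).domRestrict g, hgc.domRestrict⟩, hg1, hgn⟩
    have hq : T q = q := by
      refine Subtype.ext (ContinuousMap.ext fun s => ?_)
      obtain ⟨i, h1, h2, hs⟩ := exists_mem_Icc_nodes (by omega) s.2
      have hmem := hLinvmaps i h1 (hle h2) hs
      rw [hT q i h1 (hle h2) s hs, IccExtend_of_mem _ _ hmem]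
      change F i (Linv i s) (g (Linv i s)) = g s
      rw [← hg i h1 (hle h2) _ hmem, hLLinv i h1 (hle h2) _ hs]
    have hqp : q = p := hTK.fixedPoint_unique hq
    rw [hval x hx, ← hqp]
    rfl
  · intro j h1 h2
    rcases h2.eq_or_lt with rfl | h
    · exact hpn
    · rw [← hL1 j h1 (hle h), heq j h1 (hle h) _ ha, hp1, hF1 j h1 (hle h)]
end

section
/- Let x_1 < x_2 < ... < x_n be real numbers with data values f_1, ..., f_n ∈ ℝ. For i = 1, ..., n−1 set a_i = (x_{i+1} − x_i)/(x_n − x_1), b_i = (x_n x_i − x_1 x_{i+1})/(x_n − x_1), L_i(x) = a_i x + b_i, and F_i(x, f) = α_i f + M_i(x), where M_i(x) = p_i(x)/q_i(x) is a rational function with polynomials p_i, q_i and q_i(x) ≠ 0 for all x ∈ [x_1, x_n], and where F_i(x_1, f_1) = f_i and F_i(x_n, f_n) = f_{i+1}. Let p ≥ 1 be an integer with |α_i| < a_i^p for all i. For m = 1, ..., p define F_{i,m}(x, f) = (α_i f + M_i^{(m)}(x))/a_i^m, f_{1,m} = M_1^{(m)}(x_1)/(a_1^m − α_1), and f_{n,m}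 = M_{n−1}^{(m)}(x_n)/(a_{n−1}^m − α_{n−1}). If F_{i,m}(x_n, f_{n,m}) = F_{i+1,m}(x_1, f_{1,m}) for all i = 1, ..., n−2 and m = 1, ..., p, then the unique continuous function Φ on [x_1, x_n] satisfying Φ(L_i(x)) = α_i Φ(x) + M_i(x) for all x ∈ [x_1, x_n] and all i is p times continuously differentiable on [x_1, x_n]. -/
open Set

section FractalInterpolation

variable {N : ℕ} {y a b : ℕ → ℝ}

theorem le_of_forall_lt_succ (hy : ∀ i < N, y i < y (i + 1)) {i j : ℕ} (hij : i ≤ j)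
    (hj : j ≤ N) : y i ≤ y j := by
  induction j, hij using Nat.le_induction with
  | base => exact le_rfl
  | succ j _ ih => exact (ih (by omega)).trans (hy j (by omega)).le

/-- The subintervals of a partition cover the whole interval. -/
theorem exists_mem_Icc_succ (hN : 0 < N) {t : ℝ} (ht : t ∈ Icc (y 0) (y N)) :
    ∃ i < N, t ∈ Icc (y i) (y (i + 1)) := by
  induction N, hN using Nat.le_induction with
  | base => exact ⟨0, by simp, ht⟩
  | succ k hk ih =>
    rcases le_total t (y k) with h | h
    · obtain ⟨i, hi, hti⟩ := ih ⟨ht.1, h⟩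
      exact ⟨i, by omega, hti⟩
    · exact ⟨k, by omega, h, ht.2⟩

/-- Continuous functions that agree at the nodes of a partition can be glued. -/
theorem exists_continuous_eqOn_Icc_succ (hy : ∀ i < N, y i < y (i + 1)) (h : ℕ → ℝ → ℝ)
    (hc : ∀ i < N, Continuous (h i))
    (hm : ∀ i, i + 1 < N → h i (y (i + 1)) = h (i + 1) (y (i + 1))) :
    ∃ H : ℝ → ℝ, Continuous H ∧ ∀ i < N, EqOn H (h i) (Icc (y i) (y (i + 1))) := by
  induction N with
  | zero => exact ⟨0, continuous_zero, by simp⟩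
  | succ k ih =>
    obtain ⟨H, hH, hHe⟩ := ih (fun i hi => hy i (by omega)) (fun i hi => hc i (by omega))
      (fun i hi => hm i (by omega))
    have hk := hc k (by omega)
    rcases Nat.eq_zero_or_pos k with rfl | hk0
    · refine ⟨h 0, hk, fun i hi => ?_⟩
      obtain rfl : i = 0 := by omega
      exact fun _ _ => rfl
    obtain ⟨j, rfl⟩ : ∃ j, k = j + 1 := ⟨k - 1, by omega⟩
    refine ⟨fun t => H (min t (y (j + 1))) + h (j + 1) (max t (y (j + 1)))
      - h (j + 1) (y (j + 1)), by fun_prop, fun i hi t ht => ?_⟩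
    rcases Nat.lt_succ_iff_lt_or_eq.mp hi with hi' | rfl
    · have h1 : t ≤ y (j + 1) := ht.2.trans (le_of_forall_lt_succ hy (by omega) (by omega))
      simp [h1, hHe i hi' ht]
    · have h1 : y (j + 1) ≤ t := ht.1
      have h2 := hHe j (by omega) (right_mem_Icc.2 (hy j (by omega)).le)
      have h3 := hm j (by omega)
      simp [h1, h2, h3]

/-- Every point of the interval lies in the image of one of the affine contractions. -/
theorem exists_affine_preimage (hN : 0 < N) (ha : ∀ i < N, 0 < a i)
    (h0 : ∀ i < N, a i * y 0 + b i = y i) (h1 : ∀ i < N, a i * y N + b i = y (i + 1))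
    {t : ℝ} (ht : t ∈ Icc (y 0) (y N)) :
    ∃ i < N, ∃ s ∈ Icc (y 0) (y N), a i * s + b i = t := by
  obtain ⟨i, hi, hti⟩ := exists_mem_Icc_succ hN ht
  have hai := ha i hi
  refine ⟨i, hi, (t - b i) / a i, ⟨?_, ?_⟩, by field_simp; ring⟩
  · rw [le_div_iff₀ hai]
    linarith [h0 i hi, hti.1]
  · rw [div_le_iff₀ hai]
    linarith [h1 i hi, hti.2]

theorem affine_mem_Icc (hy : ∀ i < N, y i < y (i + 1)) (ha : ∀ i < N, 0 < a i)
    (h0 : ∀ i < N, a i * y 0 + b i = y i) (h1 : ∀ i < N, a i * y N + b i = y (i + 1))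
    {i : ℕ} (hi : i < N) {s : ℝ} (hs : s ∈ Icc (y 0) (y N)) :
    a i * s + b i ∈ Icc (y 0) (y N) := by
  have e1 := mul_le_mul_of_nonneg_left hs.1 (ha i hi).le
  have e2 := mul_le_mul_of_nonneg_left hs.2 (ha i hi).le
  have e3 := le_of_forall_lt_succ hy (Nat.zero_le i) hi.le
  have e4 := le_of_forall_lt_succ hy (show i + 1 ≤ N from hi) le_rfl
  constructor <;> linarith [h0 i hi, h1 i hi]

theorem affine_slope_le_one (hy : ∀ i < N, y i < y (i + 1))
    (h0 : ∀ i < N, a i * y 0 + b i = y i) (h1 : ∀ i < N, a i * y N + b i = y (i + 1))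
    {i : ℕ} (hi : i < N) : a i ≤ 1 := by
  have e1 := le_of_forall_lt_succ hy (Nat.zero_le i) hi.le
  have e2 := le_of_forall_lt_succ hy (show i + 1 ≤ N from hi) le_rfl
  have e3 := h0 i hi
  have e4 := h1 i hi
  have e5 := hy i hi
  by_contra! hlt
  nlinarith

/-- The Read–Bajraktarević operator maps continuous functions with the prescribed boundary values
to continuous functions. -/
theorem exists_continuous_readBajraktarevic (hy : ∀ i < N, y i < y (i + 1))
    (ha : ∀ i < N, 0 < a i)
    (h0 : ∀ i < N, a i * y 0 + b i = y i) (h1 : ∀ i < N, a i * y N + b i = y (i + 1))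
    (r : ℕ → ℝ) (g : ℕ → ℝ → ℝ) (hg : ∀ i < N, ContinuousOn (g i) (Icc (y 0) (y N)))
    {u v : ℝ}
    (hmatch : ∀ i, i + 1 < N → r i * v + g i (y N) = r (i + 1) * u + g (i + 1) (y 0))
    {G : ℝ → ℝ} (hG : ContinuousOn G (Icc (y 0) (y N))) (hGu : G (y 0) = u) (hGv : G (y N) = v) :
    ∃ H : ℝ → ℝ, Continuous H ∧
      ∀ i < N, ∀ s ∈ Icc (y 0) (y N), H (a i * s + b i) = r i * G s + g i s := by
  have h0N : y 0 ≤ y N := le_of_forall_lt_succ hy (Nat.zero_le N) le_rfl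
  have hinv0 : ∀ i < N, (y i - b i) / a i = y 0 := fun i hi => by
    have := ha i hi
    rw [← h0 i hi]; field_simp; ring
  have hinv1 : ∀ i < N, (y (i + 1) - b i) / a i = y N := fun i hi => by
    have := ha i hi
    rw [← h1 i hi]; field_simp; ring
  obtain ⟨H, hH, hHe⟩ := exists_continuous_eqOn_Icc_succ hy
    (fun i t => IccExtend h0N ((Icc (y 0) (y N)).domRestrict (fun s => r i * G s + g i s))
      ((t - b i) / a i)) (fun i hi => by
        have : Continuous ((Icc (y 0) (y N)).domRestrict (fun s => r i * G s + g i s)) :=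
          continuousOn_iff_continuous_domRestrict.1
            ((continuousOn_const.mul hG).add (hg i hi))
        exact this.Icc_extend'.comp (by fun_prop))
    (fun i hi => by
      rw [hinv1 i (by omega), hinv0 (i + 1) hi, IccExtend_of_mem _ _ (right_mem_Icc.2 h0N),
        IccExtend_of_mem _ _ (left_mem_Icc.2 h0N)]
      simpa [hGu, hGv] using hmatch i hi)
  refine ⟨H, hH, fun i hi s hs => ?_⟩
  have hai := ha i hi
  have e1 := mul_le_mul_of_nonneg_left hs.1 hai.le
  have e2 := mul_le_mul_of_nonneg_left hs.2 hai.le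
  rw [hHe i hi ⟨by linarith [h0 i hi], by linarith [h1 i hi]⟩]
  dsimp only
  rw [show (a i * s + b i - b i) / a i = s by field_simp; ring, IccExtend_of_mem _ _ hs]
  rfl

/-- Existence of a continuous fractal interpolation function. -/
theorem exists_continuous_fractalInterpolation (hN : 0 < N) (hy : ∀ i < N, y i < y (i + 1))
    (ha : ∀ i < N, 0 < a i)
    (h0 : ∀ i < N, a i * y 0 + b i = y i) (h1 : ∀ i < N, a i * y N + b i = y (i + 1))
    (r : ℕ → ℝ) (hr : ∀ i < N, |r i| < 1)
    (g : ℕ → ℝ → ℝ) (hg : ∀ i < N, ContinuousOn (g i) (Icc (y 0) (y N)))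
    {u v : ℝ} (hu : r 0 * u + g 0 (y 0) = u) (hv : r (N - 1) * v + g (N - 1) (y N) = v)
    (hmatch : ∀ i, i + 1 < N → r i * v + g i (y N) = r (i + 1) * u + g (i + 1) (y 0)) :
    ∃ Ψ : ℝ → ℝ, Continuous Ψ ∧
      ∀ i < N, ∀ s ∈ Icc (y 0) (y N), Ψ (a i * s + b i) = r i * Ψ s + g i s := by
  have h0N : y 0 ≤ y N := le_of_forall_lt_succ hy (Nat.zero_le N) le_rfl
  have h0N' : y 0 < y N := (hy 0 hN).trans_le (le_of_forall_lt_succ hy hN le_rfl)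
  let l : Icc (y 0) (y N) := ⟨y 0, left_mem_Icc.2 h0N⟩
  let e : Icc (y 0) (y N) := ⟨y N, right_mem_Icc.2 h0N⟩
  let S : Set C(Icc (y 0) (y N), ℝ) := {φ | φ l = u ∧ φ e = v}
  have hS : IsClosed S :=
    (isClosed_eq (continuous_eval_const l) continuous_const).inter
      (isClosed_eq (continuous_eval_const e) continuous_const)
  have : CompleteSpace S := hS.completeSpace_coe
  have hne : Nonempty S := by
    refine ⟨⟨⟨fun t => u + (v - u) * ((t : ℝ) - y 0) / (y N - y 0), by fun_prop⟩, ?_, ?_⟩⟩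
    · simp [l]
    · have : y N - y 0 ≠ 0 := by linarith
      simp only [ContinuousMap.coe_mk, e]
      field_simp
      ring
  have hT : ∀ φ : S, ∃ ψ : S, ∀ i < N, ∀ s (hs : s ∈ Icc (y 0) (y N))
      (hs' : a i * s + b i ∈ Icc (y 0) (y N)),
      ψ.1 ⟨a i * s + b i, hs'⟩ = r i * φ.1 ⟨s, hs⟩ + g i s := by
    intro φ
    have hext : ∀ s (hs : s ∈ Icc (y 0) (y N)), IccExtend h0N φ.1 s = φ.1 ⟨s, hs⟩ :=
      fun s hs => IccExtend_of_mem h0N _ hs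
    have hl : IccExtend h0N φ.1 (y 0) = u := (hext _ l.2).trans φ.2.1
    have he : IccExtend h0N φ.1 (y N) = v := (hext _ e.2).trans φ.2.2
    obtain ⟨H, hH, hHe⟩ := exists_continuous_readBajraktarevic hy ha h0 h1 r g hg hmatch
      (G := IccExtend h0N φ.1) (φ.1.continuous.Icc_extend').continuousOn hl he
    refine ⟨⟨⟨fun t => H t, by fun_prop⟩, ?_, ?_⟩, ?_⟩
    · have := hHe 0 hN (y 0) l.2
      rw [h0 0 hN, hl, hu] at this
      exact this
    · have := hHe (N - 1) (by omega) (y N) e.2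
      rw [h1 (N - 1) (by omega), he, hv, Nat.sub_add_cancel hN] at this
      exact this
    · intro i hi s hs hs'
      rw [← hext s hs]
      exact hHe i hi s hs
  choose T hT using hT
  obtain ⟨K, hK0, hK1, hK⟩ : ∃ K : ℝ, 0 ≤ K ∧ K < 1 ∧ ∀ i < N, |r i| ≤ K := by
    have hne' : (Finset.range N).Nonempty := ⟨0, by simpa using hN⟩
    refine ⟨(Finset.range N).sup' hne' fun i => |r i|, ?_, ?_, fun i hi => ?_⟩
    · exact (abs_nonneg (r 0)).trans
        (Finset.le_sup' (fun i => |r i|) (Finset.mem_range.2 hN))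
    · exact (Finset.sup'_lt_iff hne').2 fun i hi => hr i (Finset.mem_range.1 hi)
    · exact Finset.le_sup' (fun i => |r i|) (Finset.mem_range.2 hi)
  lift K to NNReal using hK0
  have hcontr : ContractingWith K T := by
    refine ⟨by exact_mod_cast hK1, LipschitzWith.of_dist_le_mul fun φ₁ φ₂ => ?_⟩
    rw [Subtype.dist_eq, Subtype.dist_eq,
      ContinuousMap.dist_le (mul_nonneg K.coe_nonneg dist_nonneg)]
    rintro ⟨t, ht⟩
    obtain ⟨i, hi, s, hs, rfl⟩ := exists_affine_preimage hN ha h0 h1 ht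
    rw [hT φ₁ i hi s hs, hT φ₂ i hi s hs, Real.dist_eq,
      show r i * φ₁.1 ⟨s, hs⟩ + g i s - (r i * φ₂.1 ⟨s, hs⟩ + g i s)
        = r i * (φ₁.1 ⟨s, hs⟩ - φ₂.1 ⟨s, hs⟩) by ring, abs_mul]
    exact mul_le_mul (hK i hi) (ContinuousMap.dist_apply_le_dist (f := φ₁.1) (g := φ₂.1) _)
      (abs_nonneg _) K.coe_nonneg
  have hfix := hcontr.fixedPoint_isFixedPt
  set φ := ContractingWith.fixedPoint T hcontr
  refine ⟨IccExtend h0N φ.1, φ.1.continuous.Icc_extend', fun i hi s hs => ?_⟩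
  have hs' := affine_mem_Icc hy ha h0 h1 hi hs
  rw [IccExtend_of_mem _ _ hs, IccExtend_of_mem _ _ hs', ← hT φ i hi s hs hs', hfix]

/-- A continuous function scaled by factors of modulus less than one under each of the affine
contractions vanishes. -/
theorem eqOn_zero_of_self_affine (hN : 0 < N) (hy : ∀ i < N, y i < y (i + 1))
    (ha : ∀ i < N, 0 < a i)
    (h0 : ∀ i < N, a i * y 0 + b i = y i) (h1 : ∀ i < N, a i * y N + b i = y (i + 1))
    {r : ℕ → ℝ} (hr : ∀ i < N, |r i| < 1) {D : ℝ → ℝ} (hD : ContinuousOn D (Icc (y 0) (y N)))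
    (hDe : ∀ i < N, ∀ s ∈ Icc (y 0) (y N), D (a i * s + b i) = r i * D s) :
    ∀ s ∈ Icc (y 0) (y N), D s = 0 := by
  have h0N : y 0 ≤ y N := le_of_forall_lt_succ hy (Nat.zero_le N) le_rfl
  obtain ⟨t, ht, hmax⟩ := isCompact_Icc.exists_isMaxOn (nonempty_Icc.2 h0N) hD.abs
  obtain ⟨i, hi, s, hs, rfl⟩ := exists_affine_preimage hN ha h0 h1 ht
  have hle : |D s| ≤ |D (a i * s + b i)| := hmax hs
  have hEq : |D (a i * s + b i)| = |r i| * |D s| := by rw [hDe i hi s hs, abs_mul]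
  have hs0 : |D s| = 0 := by nlinarith [hr i hi, abs_nonneg (D s)]
  intro z hz
  have hz' : |D z| ≤ |D (a i * s + b i)| := hmax hz
  rw [hEq, hs0, mul_zero] at hz'
  exact abs_nonpos_iff.1 hz'

/-- If `Ψ` solves the formally differentiated functional equation of `Φ`, and the vertical
scalings are smaller than the horizontal ones, then `Ψ` is the derivative of `Φ`. -/
theorem hasDerivWithinAt_fractalInterpolation (hN : 0 < N) (hy : ∀ i < N, y i < y (i + 1))
    (ha : ∀ i < N, 0 < a i)
    (h0 : ∀ i < N, a i * y 0 + b i = y i) (h1 : ∀ i < N, a i * y N + b i = y (i + 1))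
    {r : ℕ → ℝ} (hr : ∀ i < N, |r i| < a i) {g g' : ℕ → ℝ → ℝ}
    (hg : ∀ i < N, ∀ s ∈ Icc (y 0) (y N), HasDerivWithinAt (g i) (g' i s) (Icc (y 0) (y N)) s)
    {Φ Ψ : ℝ → ℝ} (hΦc : ContinuousOn Φ (Icc (y 0) (y N))) (hΨc : Continuous Ψ)
    (hΦ : ∀ i < N, ∀ s ∈ Icc (y 0) (y N), Φ (a i * s + b i) = r i * Φ s + g i s)
    (hΨ : ∀ i < N, ∀ s ∈ Icc (y 0) (y N), a i * Ψ (a i * s + b i) = r i * Ψ s + g' i s) :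
    ∀ s ∈ Icc (y 0) (y N), HasDerivWithinAt Φ (Ψ s) (Icc (y 0) (y N)) s := by
  have h0N : y 0 ≤ y N := le_of_forall_lt_succ hy (Nat.zero_le N) le_rfl
  have h0N' : y 0 < y N := (hy 0 hN).trans_le (le_of_forall_lt_succ hy hN le_rfl)
  have hl : y 0 ∈ Icc (y 0) (y N) := left_mem_Icc.2 h0N
  have he : y N ∈ Icc (y 0) (y N) := right_mem_Icc.2 h0N
  set G : ℝ → ℝ := fun s => Φ (y 0) + ∫ t in (y 0)..s, Ψ t with hGdef
  have hG : ∀ s, HasDerivAt G (Ψ s) s := fun s =>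
    (intervalIntegral.integral_hasDerivAt_right (hΨc.intervalIntegrable _ _)
      (hΨc.stronglyMeasurableAtFilter _ _) hΨc.continuousAt).const_add _
  have hG0 : G (y 0) = Φ (y 0) := by simp [hGdef]
  have hGconst : ∀ i < N, ∀ s ∈ Icc (y 0) (y N),
      G (a i * s + b i) - r i * G s - g i s
        = G (a i * y 0 + b i) - r i * G (y 0) - g i (y 0) := by
    intro i hi
    have hd : ∀ s ∈ Icc (y 0) (y N), HasDerivWithinAt
        (fun s => G (a i * s + b i) - r i * G s - g i s) 0 (Icc (y 0) (y N)) s := by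
      intro s hs
      have hlin : HasDerivAt (fun s => a i * s + b i) (a i) s := by
        simpa using ((hasDerivAt_id s).const_mul (a i)).add_const (b i)
      have := ((((hG (a i * s + b i)).comp s hlin).sub
        ((hG s).const_mul (r i))).hasDerivWithinAt (s := Icc (y 0) (y N))).sub (hg i hi s hs)
      refine this.congr_deriv ?_
      linarith [hΨ i hi s hs]
    exact constant_of_derivWithin_zero (fun s hs => (hd s hs).differentiableWithinAt)
      fun s hs => (hd s ⟨hs.1, hs.2.le⟩).derivWithin
        (uniqueDiffOn_Icc h0N' s ⟨hs.1, hs.2.le⟩)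
  set D : ℝ → ℝ := fun s => Φ s - G s with hDdef
  have hD0 : D (y 0) = 0 := by simp [hDdef, hG0]
  have hDe : ∀ i < N, ∀ s ∈ Icc (y 0) (y N), D (a i * s + b i) = D (y i) + r i * D s := by
    intro i hi s hs
    have e1 := hGconst i hi s hs
    have e2 := hΦ i hi s hs
    have e3 := hΦ i hi (y 0) hl
    rw [h0 i hi] at e1 e3
    simp only [hDdef]
    rw [e2, e3]
    have : r i * G (y 0) = r i * Φ (y 0) := by rw [hG0]
    linarith
  have hstep : ∀ i < N, D (y (i + 1)) - D (y i) = r i * D (y N) := by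
    intro i hi
    rw [← h1 i hi, hDe i hi _ he]
    ring
  have hDN : D (y N) = 0 := by
    have hsum : ∑ i ∈ Finset.range N, r i * D (y N) = D (y N) := by
      rw [← Finset.sum_congr rfl fun i hi => hstep i (Finset.mem_range.1 hi),
        Finset.sum_range_sub (fun i => D (y i)), hD0, sub_zero]
    have hasum : ∑ i ∈ Finset.range N, a i = 1 := by
      have : (∑ i ∈ Finset.range N, a i) * (y N - y 0) = y N - y 0 := by
        rw [Finset.sum_mul]
        refine (Finset.sum_congr rfl fun i hi => ?_).trans (Finset.sum_range_sub y N)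
        rw [← h0 i (Finset.mem_range.1 hi), ← h1 i (Finset.mem_range.1 hi)]
        ring
      exact mul_right_cancel₀ (sub_ne_zero.2 h0N'.ne') (by rw [this, one_mul])
    have hlt : ∑ i ∈ Finset.range N, r i < 1 := by
      rw [← hasum]
      exact Finset.sum_lt_sum_of_nonempty ⟨0, Finset.mem_range.2 hN⟩
        fun i hi => (le_abs_self _).trans_lt (hr i (Finset.mem_range.1 hi))
    rw [← Finset.sum_mul] at hsum
    have : (1 - ∑ i ∈ Finset.range N, r i) * D (y N) = 0 := by linarith
    exact (mul_eq_zero.1 this).resolve_left (by linarith)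
  have hDy : ∀ i ≤ N, D (y i) = 0 := by
    intro i
    induction i with
    | zero => exact fun _ => hD0
    | succ i ih =>
      intro hi
      have := hstep i hi
      rw [hDN, ih (by omega)] at this
      simpa using this
  have ha1 : ∀ i < N, a i ≤ 1 := fun i hi => affine_slope_le_one hy h0 h1 hi
  have hGc : Continuous G := continuous_iff_continuousAt.2 fun s => (hG s).continuousAt
  have hDz := eqOn_zero_of_self_affine hN hy ha h0 h1
    (fun i hi => (hr i hi).trans_le (ha1 i hi)) (D := D) (hΦc.sub hGc.continuousOn)
    (fun i hi s hs => by rw [hDe i hi s hs, hDy i hi.le, zero_add])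
  intro s hs
  exact (hG s).hasDerivWithinAt.congr (fun t ht => sub_eq_zero.1 (hDz t ht))
    (sub_eq_zero.1 (hDz s hs))

theorem contDiffOn_of_forall_hasDerivWithinAt {s : Set ℝ} (hs : UniqueDiffOn ℝ s)
    {Ψ : ℕ → ℝ → ℝ} (k m : ℕ) (hc : ContinuousOn (Ψ (m + k)) s)
    (hd : ∀ j < m + k, ∀ t ∈ s, HasDerivWithinAt (Ψ j) (Ψ (j + 1) t) s t) :
    ContDiffOn ℝ k (Ψ m) s := by
  induction k generalizing m with
  | zero => simpa using hc
  | succ k ih =>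
    have hdm := hd m (by omega)
    rw [Nat.cast_add, Nat.cast_one, contDiffOn_succ_iff_derivWithin hs]
    refine ⟨fun t ht => (hdm t ht).differentiableWithinAt, by simp, ?_⟩
    refine (ih (m + 1) (by convert hc using 2; omega) fun j hj => hd j (by omega)).congr ?_
    exact fun t ht => (hdm t ht).derivWithin (hs t ht)

/-- Smoothness of fractal interpolation functions whose derivative data match at the nodes. -/
theorem contDiffOn_fractalInterpolation (hN : 0 < N) (hy : ∀ i < N, y i < y (i + 1))
    (ha : ∀ i < N, 0 < a i)
    (h0 : ∀ i < N, a i * y 0 + b i = y i) (h1 : ∀ i < N, a i * y N + b i = y (i + 1))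
    {P : ℕ} {α : ℕ → ℝ} (hα : ∀ i < N, |α i| < a i ^ P) {M : ℕ → ℝ → ℝ}
    (hM : ∀ i < N, ContDiffOn ℝ P (M i) (Icc (y 0) (y N))) {u v : ℕ → ℝ}
    (hu : ∀ m, 1 ≤ m → m ≤ P →
      u m = iteratedDerivWithin m (M 0) (Icc (y 0) (y N)) (y 0) / (a 0 ^ m - α 0))
    (hv : ∀ m, 1 ≤ m → m ≤ P →
      v m = iteratedDerivWithin m (M (N - 1)) (Icc (y 0) (y N)) (y N) /
        (a (N - 1) ^ m - α (N - 1)))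
    (hmatch : ∀ i, i + 1 < N → ∀ m, 1 ≤ m → m ≤ P →
      (α i * v m + iteratedDerivWithin m (M i) (Icc (y 0) (y N)) (y N)) / a i ^ m =
      (α (i + 1) * u m + iteratedDerivWithin m (M (i + 1)) (Icc (y 0) (y N)) (y 0)) /
        a (i + 1) ^ m)
    {Φ : ℝ → ℝ} (hΦc : ContinuousOn Φ (Icc (y 0) (y N)))
    (hΦ : ∀ i < N, ∀ s ∈ Icc (y 0) (y N), Φ (a i * s + b i) = α i * Φ s + M i s) :
    ContDiffOn ℝ P Φ (Icc (y 0) (y N)) := by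
  have h0N' : y 0 < y N := (hy 0 hN).trans_le (le_of_forall_lt_succ hy hN le_rfl)
  have huniq : UniqueDiffOn ℝ (Icc (y 0) (y N)) := uniqueDiffOn_Icc h0N'
  have ha1 : ∀ i < N, a i ≤ 1 := fun i hi => affine_slope_le_one hy h0 h1 hi
  have hαm : ∀ m ≤ P, ∀ i < N, |α i| < a i ^ m := fun m hm i hi =>
    (hα i hi).trans_le (pow_le_pow_of_le_one (ha i hi).le (ha1 i hi) hm)
  have hfix : ∀ m ≤ P, ∀ i < N, ∀ w c : ℝ, w = c / (a i ^ m - α i) →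
      α i / a i ^ m * w + c / a i ^ m = w := by
    intro m hm i hi w c hw
    have e1 : 0 < a i ^ m - α i := sub_pos.2 ((le_abs_self _).trans_lt (hαm m hm i hi))
    have e2 : 0 < a i ^ m := pow_pos (ha i hi) m
    rw [eq_div_iff e1.ne'] at hw
    field_simp
    linarith
  have hex : ∀ m, ∃ Ψ : ℝ → ℝ, 1 ≤ m → m ≤ P → Continuous Ψ ∧
      ∀ i < N, ∀ s ∈ Icc (y 0) (y N), Ψ (a i * s + b i) = α i / a i ^ m * Ψ s +
        iteratedDerivWithin m (M i) (Icc (y 0) (y N)) s / a i ^ m := by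
    intro m
    by_cases hm : 1 ≤ m ∧ m ≤ P
    · obtain ⟨Ψ, hΨ⟩ := exists_continuous_fractalInterpolation hN hy ha h0 h1
        (fun i => α i / a i ^ m) (fun i hi => by
          have := pow_pos (ha i hi) m
          rw [abs_div, abs_of_pos this, div_lt_one this]
          exact hαm m hm.2 i hi)
        (fun i s => iteratedDerivWithin m (M i) (Icc (y 0) (y N)) s / a i ^ m)
        (fun i hi => ((hM i hi).continuousOn_iteratedDerivWithin
          (by exact_mod_cast hm.2) huniq).div_const _)
        (u := u m) (v := v m) (hfix m hm.2 0 hN _ _ (hu m hm.1 hm.2))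
        (hfix m hm.2 (N - 1) (by omega) _ _ (hv m hm.1 hm.2))
        (fun i hi => by
          have := hmatch i hi m hm.1 hm.2
          rw [add_div, add_div] at this
          rw [div_mul_eq_mul_div, div_mul_eq_mul_div]
          exact this)
      exact ⟨Ψ, fun _ _ => hΨ⟩
    · exact ⟨0, fun h h' => absurd ⟨h, h'⟩ hm⟩
  choose Ψ₀ hΨ₀ using hex
  let Ψ : ℕ → ℝ → ℝ := fun m => if m = 0 then Φ else Ψ₀ m
  have hΨs : ∀ m, Ψ (m + 1) = Ψ₀ (m + 1) := fun m => by simp [Ψ]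
  have hΨc : ∀ m ≤ P, ContinuousOn (Ψ m) (Icc (y 0) (y N)) := by
    rintro (_ | m) hm
    · exact hΦc
    · rw [hΨs]
      exact (hΨ₀ (m + 1) (by omega) hm).1.continuousOn
  have hΨ : ∀ m ≤ P, ∀ i < N, ∀ s ∈ Icc (y 0) (y N), Ψ m (a i * s + b i) =
      α i / a i ^ m * Ψ m s + iteratedDerivWithin m (M i) (Icc (y 0) (y N)) s / a i ^ m := by
    rintro (_ | m) hm i hi s hs
    · simpa [Ψ] using hΦ i hi s hs
    · rw [hΨs]
      exact (hΨ₀ (m + 1) (by omega) hm).2 i hi s hs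
  refine contDiffOn_of_forall_hasDerivWithinAt huniq (Ψ := Ψ) P 0 (hΨc _ (by omega)) ?_
  intro m hm
  rw [zero_add] at hm
  refine hasDerivWithinAt_fractalInterpolation hN hy ha h0 h1
    (r := fun i => α i / a i ^ m)
    (g := fun i s => iteratedDerivWithin m (M i) (Icc (y 0) (y N)) s / a i ^ m)
    (g' := fun i s => iteratedDerivWithin (m + 1) (M i) (Icc (y 0) (y N)) s / a i ^ m)
    ?_ ?_ (hΨc m hm.le) ?_ (hΨ m hm.le) ?_
  · intro i hi
    have := pow_pos (ha i hi) m
    rw [abs_div, abs_of_pos this, div_lt_iff₀ this, ← pow_succ']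
    exact hαm (m + 1) hm i hi
  · intro i hi s hs
    have hdiff := (hM i hi).differentiableOn_iteratedDerivWithin
      (by exact_mod_cast hm) huniq s hs
    rw [iteratedDerivWithin_succ]
    exact hdiff.hasDerivWithinAt.div_const _
  · rw [hΨs]
    exact (hΨ₀ (m + 1) (by omega) hm).1
  · intro i hi s hs
    have := ha i hi
    rw [hΨ (m + 1) hm i hi s hs]
    field_simp
    ring

end FractalInterpolation


/-- (Existence of rational spline FIFs, smoothness part.)
Under the matching conditions on the derivative data, the (unique) continuous
function `Φ` satisfying `Φ (L i x) = α i * Φ x + M i x` on `[x 1, x n]` is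
`p` times continuously differentiable there. -/
theorem rational_spline_FIF_smoothness
    (n : ℕ) (hn : 2 ≤ n)
    (x f : ℕ → ℝ)
    (hx : ∀ i, 1 ≤ i → i ≤ n - 1 → x i < x (i + 1))
    (α : ℕ → ℝ)
    (a b : ℕ → ℝ)
    (ha : ∀ i, 1 ≤ i → i ≤ n - 1 → a i = (x (i + 1) - x i) / (x n - x 1))
    (hb : ∀ i, 1 ≤ i → i ≤ n - 1 → b i = (x n * x i - x 1 * x (i + 1)) / (x n - x 1))
    (L : ℕ → ℝ → ℝ)
    (hL : ∀ i, 1 ≤ i → i ≤ n - 1 → ∀ s : ℝ, L i s = a i * s + b i)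
    (p q : ℕ → Polynomial ℝ)
    (M : ℕ → ℝ → ℝ)
    (hM : ∀ i, 1 ≤ i → i ≤ n - 1 → ∀ s : ℝ, M i s = (p i).eval s / (q i).eval s)
    (hq : ∀ i, 1 ≤ i → i ≤ n - 1 → ∀ s ∈ Icc (x 1) (x n), (q i).eval s ≠ 0)
    -- endpoint interpolation conditions `F i (x 1, f 1) = f i`, `F i (x n, f n) = f (i+1)`
    (hF1 : ∀ i, 1 ≤ i → i ≤ n - 1 → α i * f 1 + M i (x 1) = f i)
    (hFn : ∀ i, 1 ≤ i → i ≤ n - 1 → α i * f n + M i (x n) = f (i + 1))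
    (P : ℕ) (hP : 1 ≤ P)
    (hα : ∀ i, 1 ≤ i → i ≤ n - 1 → |α i| < (a i) ^ P)
    (f1m fnm : ℕ → ℝ)
    (hf1m : ∀ m, 1 ≤ m → m ≤ P →
      f1m m = iteratedDerivWithin m (M 1) (Icc (x 1) (x n)) (x 1) / ((a 1) ^ m - α 1))
    (hfnm : ∀ m, 1 ≤ m → m ≤ P →
      fnm m = iteratedDerivWithin m (M (n - 1)) (Icc (x 1) (x n)) (x n) /
        ((a (n - 1)) ^ m - α (n - 1)))
    -- the matching conditions `F_{i,m}(x_n, f_{n,m}) = F_{i+1,m}(x_1, f_{1,m})`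
    (hmatch : ∀ i, 1 ≤ i → i ≤ n - 2 → ∀ m, 1 ≤ m → m ≤ P →
      (α i * fnm m + iteratedDerivWithin m (M i) (Icc (x 1) (x n)) (x n)) / (a i) ^ m =
      (α (i + 1) * f1m m +
          iteratedDerivWithin m (M (i + 1)) (Icc (x 1) (x n)) (x 1)) / (a (i + 1)) ^ m)
    (Φ : ℝ → ℝ)
    (hΦcont : ContinuousOn Φ (Icc (x 1) (x n)))
    (hΦ : ∀ i, 1 ≤ i → i ≤ n - 1 → ∀ s ∈ Icc (x 1) (x n),
      Φ (L i s) = α i * Φ s + M i s) :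
    ContDiffOn ℝ P Φ (Icc (x 1) (x n)) := by
  obtain ⟨N, rfl⟩ : ∃ N, n = N + 1 := ⟨n - 1, by omega⟩
  simp only [Nat.add_sub_cancel] at hx ha hb hL hM hq hα hfnm hΦ
  have hN : 0 < N := by omega
  have hy : ∀ i < N, x (i + 1) < x (i + 1 + 1) := fun i hi => hx (i + 1) (by omega) (by omega)
  have hlt : x 1 < x (N + 1) :=
    (hy 0 hN).trans_le (le_of_forall_lt_succ (y := fun i => x (i + 1)) hy hN le_rfl)
  have hne : x (N + 1) - x 1 ≠ 0 := sub_ne_zero.2 hlt.ne'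
  refine contDiffOn_fractalInterpolation (N := N) (y := fun i => x (i + 1))
    (a := fun i => a (i + 1)) (b := fun i => b (i + 1)) (α := fun i => α (i + 1))
    (M := fun i => M (i + 1)) (u := f1m) (v := fnm) hN hy ?_ ?_ ?_
    (fun i hi => hα (i + 1) (by omega) (by omega)) ?_ hf1m ?_ ?_ hΦcont ?_
  · intro i hi
    rw [ha (i + 1) (by omega) (by omega)]
    exact div_pos (sub_pos.2 (hy i hi)) (sub_pos.2 hlt)
  · intro i hi
    rw [ha (i + 1) (by omega) (by omega), hb (i + 1) (by omega) (by omega), zero_add]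
    field_simp
    ring
  · intro i hi
    rw [ha (i + 1) (by omega) (by omega), hb (i + 1) (by omega) (by omega)]
    field_simp
    ring
  · intro i hi
    refine ContDiffOn.congr (f := fun s => (p (i + 1)).eval s / (q (i + 1)).eval s) ?_
      fun s _ => hM (i + 1) (by omega) (by omega) s
    have hpoly (r : Polynomial ℝ) : ContDiff ℝ P fun s => r.eval s := by
      simpa using r.contDiff_aeval (𝕜 := ℝ) P
    exact (hpoly _).contDiffOn.div (hpoly _).contDiffOn (hq (i + 1) (by omega) (by omega))
  · intro m h1m hmP
    rw [Nat.sub_add_cancel hN]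
    exact hfnm m h1m hmP
  · exact fun i hi => hmatch (i + 1) (by omega) (by omega)
  · intro i hi s hs
    rw [← hΦ (i + 1) (by omega) (by omega) s hs, hL (i + 1) (by omega) (by omega)]
end

section
/- Let t_1 < t_2 < ... < t_n be real numbers (n ≥ 3) with data values f_1, ..., f_n ∈ ℝ, and let ε = (ε_1, ..., ε_{n−1}) ∈ {0,1}^{n−1} be a signature. For j = 1, ..., n−1 set a_j = (t_{j+1−ε_j} − t_{j+ε_j})/(t_n − t_1), b_j = (t_n t_{j+ε_j} − t_1 t_{j+1−ε_j})/(t_n − t_1), and L_{j,ε}(t) = a_j t + b_j, so that L_{j,ε}(t_1) = t_{j+ε_j}, L_{j,ε}(t_n) = t_{j+1−ε_j}, and L_{j,ε} maps [t_1, t_n] bijectively onto [t_j, t_{j+1}]. Let λ_j ∈ ℝ with |λ_j| < 1 and let M_{j,ε} : [t_1, t_n] → ℝ be continuous with M_{j,ε}(t_1) = f_{j+ε_j} − λ_j f_1 and M_{j,ε}(t_n) = f_{j+1−ε_j} − λ_j f_n. Then there exists a unique continuous function φ_ε : [t_1, t_n] → ℝ with φ_ε(t_1) = f_1 and φ_ε(t_n)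 = f_n satisfying φ_ε(L_{j,ε}(t)) = λ_j φ_ε(t) + M_{j,ε}(t) for all t ∈ [t_1, t_n] and all j = 1, ..., n−1; moreover φ_ε(t_i) = f_i for every i = 1, ..., n. -/
open Set

theorem monotoneOn_nodes {n : ℕ} {t : ℕ → ℝ}
    (ht : ∀ j ∈ Finset.Ico 1 n, t j ≤ t (j + 1)) : MonotoneOn t (Icc 1 n) := by
  intro i hi j hj hij
  have hj' : j ≤ n := hj.2
  clear hj
  induction j, hij using Nat.le_induction with
  | base => exact le_rfl
  | succ k hk ih =>
    have hi1 : 1 ≤ i := hi.1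
    exact (ih (by omega)).trans (ht k (Finset.mem_Ico.2 ⟨by omega, by omega⟩))

theorem exists_mem_Icc_nodes_s3 {n : ℕ} (hn : 2 ≤ n) (t : ℕ → ℝ) {x : ℝ}
    (hx : x ∈ Icc (t 1) (t n)) : ∃ k ∈ Finset.Ico 1 n, x ∈ Icc (t k) (t (k + 1)) := by
  induction n, hn using Nat.le_induction with
  | base => exact ⟨1, by simp, hx⟩
  | succ m hm ih =>
    rcases le_total x (t m) with h | h
    · obtain ⟨k, hk, hxk⟩ := ih ⟨hx.1, h⟩
      rw [Finset.mem_Ico] at hk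
      exact ⟨k, Finset.mem_Ico.2 ⟨hk.1, by omega⟩, hxk⟩
    · exact ⟨m, Finset.mem_Ico.2 ⟨by omega, by omega⟩, h, hx.2⟩

/-- Functions that are constant off consecutive intervals, with matching constants, are glued by
summing their increments. -/
theorem add_sum_sub_eq_of_mem_Icc {n : ℕ} {t f : ℕ → ℝ} {H : ℕ → ℝ → ℝ}
    (ht : ∀ j ∈ Finset.Ico 1 n, t j ≤ t (j + 1))
    (hleft : ∀ j ∈ Finset.Ico 1 n, ∀ x ≤ t j, H j x = f j)
    (hright : ∀ j ∈ Finset.Ico 1 n, ∀ x, t (j + 1) ≤ x → H j x = f (j + 1))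
    {k : ℕ} (hk : k ∈ Finset.Ico 1 n) {x : ℝ} (hx : x ∈ Icc (t k) (t (k + 1))) :
    f 1 + ∑ j ∈ Finset.Ico 1 n, (H j x - f j) = H k x := by
  have hmono := monotoneOn_nodes ht
  obtain ⟨hk1, hkn⟩ := Finset.mem_Ico.1 hk
  have hlow : ∑ j ∈ Finset.Ico 1 k, (H j x - f j) = f k - f 1 := by
    rw [← Finset.sum_Ico_sub f hk1]
    refine Finset.sum_congr rfl fun j hj => ?_
    rw [Finset.mem_Ico] at hj
    rw [hright j (Finset.mem_Ico.2 ⟨hj.1, by omega⟩) x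
      ((hmono ⟨by omega, by omega⟩ ⟨hk1, hkn.le⟩ (by omega)).trans hx.1)]
  have hhigh : ∑ j ∈ Finset.Ico (k + 1) n, (H j x - f j) = 0 := by
    refine Finset.sum_eq_zero fun j hj => ?_
    rw [Finset.mem_Ico] at hj
    rw [hleft j (Finset.mem_Ico.2 ⟨by omega, hj.2⟩) x
      (hx.2.trans (hmono ⟨by omega, by omega⟩ ⟨by omega, by omega⟩ hj.1)), sub_self]
  rw [← Finset.sum_Ico_consecutive _ hk1 hkn.le, Finset.sum_eq_sum_Ico_succ_bot hkn, hlow, hhigh]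
  ring

theorem exists_nnreal_lt_one_forall_abs_le (s : Finset ℕ) (lam : ℕ → ℝ)
    (hlam : ∀ j ∈ s, |lam j| < 1) : ∃ K : NNReal, K < 1 ∧ ∀ j ∈ s, |lam j| ≤ K := by
  refine ⟨s.sup fun j => ‖lam j‖₊, ?_, fun j hj => ?_⟩
  · rw [Finset.sup_lt_iff (by simp)]
    intro j hj
    exact_mod_cast hlam j hj
  · exact_mod_cast Finset.le_sup (f := fun j => ‖lam j‖₊) hj

/-- Unique solvability of the Read–Bajraktarević equation: `q j` plays the role of the inverse
of the `j`-th contraction. -/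
theorem existsUnique_readBajraktarevic {n : ℕ} (hn : 2 ≤ n) {t f : ℕ → ℝ}
    (ht : ∀ j ∈ Finset.Ico 1 n, t j ≤ t (j + 1)) (h1n : t 1 < t n)
    {q : ℕ → ℝ → Icc (t 1) (t n)} (hq : ∀ j ∈ Finset.Ico 1 n, Continuous (q j))
    {lam : ℕ → ℝ} (hlam : ∀ j ∈ Finset.Ico 1 n, |lam j| < 1)
    {M : ℕ → ℝ → ℝ} (hM : ∀ j ∈ Finset.Ico 1 n, ContinuousOn (M j) (Icc (t 1) (t n)))
    (hleft : ∀ j ∈ Finset.Ico 1 n, ∀ g : Icc (t 1) (t n) → ℝ,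
      g ⟨t 1, left_mem_Icc.2 h1n.le⟩ = f 1 → g ⟨t n, right_mem_Icc.2 h1n.le⟩ = f n →
      ∀ x ≤ t j, lam j * g (q j x) + M j (q j x) = f j)
    (hright : ∀ j ∈ Finset.Ico 1 n, ∀ g : Icc (t 1) (t n) → ℝ,
      g ⟨t 1, left_mem_Icc.2 h1n.le⟩ = f 1 → g ⟨t n, right_mem_Icc.2 h1n.le⟩ = f n →
      ∀ x, t (j + 1) ≤ x → lam j * g (q j x) + M j (q j x) = f (j + 1)) :
    ∃! g : C(Icc (t 1) (t n), ℝ),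
      g ⟨t 1, left_mem_Icc.2 h1n.le⟩ = f 1 ∧ g ⟨t n, right_mem_Icc.2 h1n.le⟩ = f n ∧
      ∀ j ∈ Finset.Ico 1 n, ∀ x : Icc (t 1) (t n), (x : ℝ) ∈ Icc (t j) (t (j + 1)) →
        g x = lam j * g (q j x) + M j (q j x) := by
  set l : Icc (t 1) (t n) := ⟨t 1, left_mem_Icc.2 h1n.le⟩ with hl
  set r : Icc (t 1) (t n) := ⟨t n, right_mem_Icc.2 h1n.le⟩ with hr
  let S : Set C(Icc (t 1) (t n), ℝ) := {g | g l = f 1 ∧ g r = f n}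
  have hSclosed : IsClosed S :=
    (isClosed_eq (continuous_eval_const l) continuous_const).inter
      (isClosed_eq (continuous_eval_const r) continuous_const)
  have : CompleteSpace S := hSclosed.completeSpace_coe
  have : Nonempty S := by
    refine ⟨⟨fun x => f 1 + (x - t 1) / (t n - t 1) * (f n - f 1), by fun_prop⟩, ?_, ?_⟩
    · simp [hl]
    · have : t n - t 1 ≠ 0 := (sub_pos.2 h1n).ne'
      simp [hr, this]
  let T₀ : C(Icc (t 1) (t n), ℝ) → C(Icc (t 1) (t n), ℝ) := fun g =>
    ⟨fun x => f 1 + ∑ j ∈ Finset.Ico 1 n, (lam j * g (q j x) + M j (q j x) - f j), by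
      refine continuous_const.add (continuous_finsetSum _ fun j hj => ?_)
      have hqj : Continuous fun x : Icc (t 1) (t n) => q j x :=
        (hq j hj).comp continuous_subtype_val
      exact ((continuous_const.mul (g.continuous.comp hqj)).add
        ((hM j hj).domRestrict.comp hqj)).sub continuous_const⟩
  have hT₀ : ∀ g ∈ S, ∀ k ∈ Finset.Ico 1 n, ∀ x : Icc (t 1) (t n),
      (x : ℝ) ∈ Icc (t k) (t (k + 1)) → T₀ g x = lam k * g (q k x) + M k (q k x) :=
    fun g hg k hk x hx =>
      add_sum_sub_eq_of_mem_Icc (H := fun j x => lam j * g (q j x) + M j (q j x)) ht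
        (fun j hj => hleft j hj g hg.1 hg.2) (fun j hj => hright j hj g hg.1 hg.2) hk hx
  have hmaps : ∀ g ∈ S, T₀ g ∈ S := by
    intro g hg
    have h1 : 1 ∈ Finset.Ico 1 n := Finset.mem_Ico.2 ⟨le_rfl, by omega⟩
    have hn1 : n - 1 ∈ Finset.Ico 1 n := Finset.mem_Ico.2 ⟨by omega, by omega⟩
    have hnn : n - 1 + 1 = n := by omega
    have hlast := ht _ hn1
    have hlast' := hright _ hn1 g hg.1 hg.2 (t n)
    rw [hnn] at hlast hlast'
    refine ⟨?_, ?_⟩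
    · rw [hT₀ g hg 1 h1 l ⟨le_rfl, ht 1 h1⟩]
      exact hleft 1 h1 g hg.1 hg.2 _ le_rfl
    · rw [hT₀ g hg (n - 1) hn1 r ⟨hlast, by rw [hnn]⟩]
      exact hlast' le_rfl
  obtain ⟨K, hK1, hK⟩ := exists_nnreal_lt_one_forall_abs_le _ lam hlam
  let T : S → S := fun g => ⟨T₀ g, hmaps g g.2⟩
  have hT : ContractingWith K T := by
    refine ⟨hK1, LipschitzWith.of_dist_le_mul fun g g' => ?_⟩
    refine (ContinuousMap.dist_le (by positivity)).2 fun x => ?_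
    obtain ⟨k, hk, hxk⟩ := exists_mem_Icc_nodes_s3 hn t x.2
    rw [hT₀ g g.2 k hk x hxk, hT₀ g' g'.2 k hk x hxk, dist_add_right, Real.dist_eq, ← mul_sub,
      abs_mul, ← Real.dist_eq]
    exact mul_le_mul (hK k hk) (ContinuousMap.dist_apply_le_dist _) dist_nonneg K.2
  obtain ⟨g₀, hfix⟩ : ∃ g₀, T g₀ = g₀ := ⟨_, hT.fixedPoint_isFixedPt⟩
  refine ⟨g₀, ⟨g₀.2.1, g₀.2.2, ?_⟩, ?_⟩
  · intro j hj x hx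
    conv_lhs => rw [← hfix]
    exact hT₀ _ g₀.2 j hj x hx
  · rintro g ⟨hg1, hgn, hg⟩
    have hgfix : Function.IsFixedPt T ⟨g, hg1, hgn⟩ := by
      refine Subtype.ext (ContinuousMap.ext fun x => ?_)
      obtain ⟨k, hk, hxk⟩ := exists_mem_Icc_nodes_s3 hn t x.2
      exact (hT₀ g ⟨hg1, hgn⟩ k hk x hxk).trans (hg k hk x hxk).symm
    exact congrArg Subtype.val (hT.fixedPoint_unique' hgfix hfix)

/-- Existence, uniqueness and interpolation property of the zipper
fractal interpolation function `φ_ε` with signature `ε ∈ {0,1}^{n-1}`. -/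
theorem zipper_fractal_interpolation_function_exists_unique
    (n : ℕ) (hn : 3 ≤ n)
    (t f : ℕ → ℝ)
    (ht : ∀ i, 1 ≤ i → i ≤ n - 1 → t i < t (i + 1))
    (ε : ℕ → ℕ) (hε : ∀ j, 1 ≤ j → j ≤ n - 1 → ε j = 0 ∨ ε j = 1)
    (a b : ℕ → ℝ)
    (ha : ∀ j, 1 ≤ j → j ≤ n - 1 →
      a j = (t (j + 1 - ε j) - t (j + ε j)) / (t n - t 1))
    (hb : ∀ j, 1 ≤ j → j ≤ n - 1 →
      b j = (t n * t (j + ε j) - t 1 * t (j + 1 - ε j)) / (t n - t 1))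
    (L : ℕ → ℝ → ℝ)
    (hL : ∀ j, 1 ≤ j → j ≤ n - 1 → ∀ s : ℝ, L j s = a j * s + b j)
    (lam : ℕ → ℝ)
    (hlam : ∀ j, 1 ≤ j → j ≤ n - 1 → |lam j| < 1)
    (M : ℕ → ℝ → ℝ)
    (hMcont : ∀ j, 1 ≤ j → j ≤ n - 1 → ContinuousOn (M j) (Icc (t 1) (t n)))
    (hM1 : ∀ j, 1 ≤ j → j ≤ n - 1 → M j (t 1) = f (j + ε j) - lam j * f 1)
    (hMn : ∀ j, 1 ≤ j → j ≤ n - 1 → M j (t n) = f (j + 1 - ε j) - lam j * f n) :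
    ∃ φ : ℝ → ℝ,
      (ContinuousOn φ (Icc (t 1) (t n)) ∧
        φ (t 1) = f 1 ∧ φ (t n) = f n ∧
        ∀ j, 1 ≤ j → j ≤ n - 1 → ∀ s ∈ Icc (t 1) (t n),
          φ (L j s) = lam j * φ s + M j s) ∧
      -- uniqueness (as functions on `[t 1, t n]`)
      (∀ ψ : ℝ → ℝ,
        (ContinuousOn ψ (Icc (t 1) (t n)) ∧
          ψ (t 1) = f 1 ∧ ψ (t n) = f n ∧
          ∀ j, 1 ≤ j → j ≤ n - 1 → ∀ s ∈ Icc (t 1) (t n),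
            ψ (L j s) = lam j * ψ s + M j s) →
        EqOn ψ φ (Icc (t 1) (t n))) ∧
      -- interpolation of the data
      (∀ i, 1 ≤ i → i ≤ n → φ (t i) = f i) := by
  have hmem : ∀ j ∈ Finset.Ico 1 n, 1 ≤ j ∧ j ≤ n - 1 := fun j hj => by
    rw [Finset.mem_Ico] at hj; omega
  have hmem' : ∀ j, 1 ≤ j → j ≤ n - 1 → j ∈ Finset.Ico 1 n := fun j h1 h2 =>
    Finset.mem_Ico.2 ⟨h1, by omega⟩
  have hlt : ∀ j ∈ Finset.Ico 1 n, t j < t (j + 1) := fun j hj =>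
    ht j (hmem j hj).1 (hmem j hj).2
  have hle : ∀ j ∈ Finset.Ico 1 n, t j ≤ t (j + 1) := fun j hj => (hlt j hj).le
  have hmono := monotoneOn_nodes hle
  have h1n : t 1 < t n := (ht 1 le_rfl (by omega)).trans_le
    (hmono ⟨by omega, by omega⟩ ⟨by omega, le_rfl⟩ (by omega))
  have hpos : 0 < t n - t 1 := sub_pos.2 h1n
  have hcases : ∀ j ∈ Finset.Ico 1 n,
      (0 < a j ∧ a j * t 1 + b j = t j ∧ a j * t n + b j = t (j + 1) ∧
        M j (t 1) = f j - lam j * f 1 ∧ M j (t n) = f (j + 1) - lam j * f n) ∨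
      (a j < 0 ∧ a j * t 1 + b j = t (j + 1) ∧ a j * t n + b j = t j ∧
        M j (t 1) = f (j + 1) - lam j * f 1 ∧ M j (t n) = f j - lam j * f n) := by
    intro j hj
    obtain ⟨h1, h2⟩ := hmem j hj
    have hd := sub_pos.2 (hlt j hj)
    have e1 := hM1 j h1 h2
    have e2 := hMn j h1 h2
    have ea := ha j h1 h2
    have eb := hb j h1 h2
    rcases hε j h1 h2 with h | h
    · simp only [h, Nat.add_zero, Nat.sub_zero] at e1 e2 ea eb
      refine Or.inl ⟨ea ▸ div_pos hd hpos, ?_, ?_, e1, e2⟩ <;> rw [ea, eb] <;> field_simp <;> ring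
    · simp only [h, Nat.add_sub_cancel] at e1 e2 ea eb
      refine Or.inr ⟨ea ▸ div_neg_of_neg_of_pos (by linarith) hpos, ?_, ?_, e1, e2⟩ <;>
        rw [ea, eb] <;> field_simp <;> ring
  have ha0 : ∀ j ∈ Finset.Ico 1 n, a j ≠ 0 := fun j hj =>
    (hcases j hj).elim (fun h => h.1.ne') fun h => h.1.ne
  have hLmem : ∀ j ∈ Finset.Ico 1 n, ∀ s ∈ Icc (t 1) (t n),
      a j * s + b j ∈ Icc (t j) (t (j + 1)) := by
    rintro j hj s ⟨hs1, hs2⟩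
    rcases hcases j hj with ⟨h, e1, e2, -, -⟩ | ⟨h, e1, e2, -, -⟩ <;> constructor <;> nlinarith
  have hinv : ∀ j ∈ Finset.Ico 1 n, ∀ x ∈ Icc (t j) (t (j + 1)),
      (x - b j) / a j ∈ Icc (t 1) (t n) := by
    rintro j hj x ⟨hx1, hx2⟩
    rcases hcases j hj with ⟨h, e1, e2, -, -⟩ | ⟨h, e1, e2, -, -⟩
    · exact ⟨(le_div_iff₀ h).2 (by linarith), (div_le_iff₀ h).2 (by linarith)⟩
    · exact ⟨(le_div_iff_of_neg h).2 (by linarith), (div_le_iff_of_neg h).2 (by linarith)⟩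
  let q : ℕ → ℝ → Icc (t 1) (t n) := fun j x => projIcc (t 1) (t n) h1n.le ((x - b j) / a j)
  have hqL : ∀ j ∈ Finset.Ico 1 n, ∀ s : Icc (t 1) (t n), q j (a j * s + b j) = s := by
    intro j hj s
    have : (a j * s + b j - b j) / a j = s := by
      rw [add_sub_cancel_right, mul_div_cancel_left₀ _ (ha0 j hj)]
    simp only [q, this, projIcc_val]
  have hLq : ∀ j ∈ Finset.Ico 1 n, ∀ x ∈ Icc (t j) (t (j + 1)), a j * q j x + b j = x := by
    intro j hj x hx
    simp only [q, projIcc_of_mem h1n.le (hinv j hj x hx)]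
    rw [mul_div_cancel₀ _ (ha0 j hj), sub_add_cancel]
  have hsub : ∀ j ∈ Finset.Ico 1 n, Icc (t j) (t (j + 1)) ⊆ Icc (t 1) (t n) := by
    intro j hj
    rw [Finset.mem_Ico] at hj
    exact Icc_subset_Icc (hmono ⟨by omega, by omega⟩ ⟨by omega, by omega⟩ hj.1)
      (hmono ⟨by omega, by omega⟩ ⟨by omega, by omega⟩ (by omega))
  have hleft : ∀ j ∈ Finset.Ico 1 n, ∀ g : Icc (t 1) (t n) → ℝ,
      g ⟨t 1, left_mem_Icc.2 h1n.le⟩ = f 1 → g ⟨t n, right_mem_Icc.2 h1n.le⟩ = f n →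
      ∀ x ≤ t j, lam j * g (q j x) + M j (q j x) = f j := by
    intro j hj g hg1 hgn x hx
    rcases hcases j hj with ⟨h, e1, e2, m1, m2⟩ | ⟨h, e1, e2, m1, m2⟩
    · have : q j x = ⟨t 1, left_mem_Icc.2 h1n.le⟩ :=
        projIcc_of_le_left _ ((div_le_iff₀ h).2 (by linarith))
      rw [this, hg1, m1]; ring
    · have : q j x = ⟨t n, right_mem_Icc.2 h1n.le⟩ :=
        projIcc_of_right_le _ ((le_div_iff_of_neg h).2 (by linarith))
      rw [this, hgn, m2]; ring
  have hright : ∀ j ∈ Finset.Ico 1 n, ∀ g : Icc (t 1) (t n) → ℝ,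
      g ⟨t 1, left_mem_Icc.2 h1n.le⟩ = f 1 → g ⟨t n, right_mem_Icc.2 h1n.le⟩ = f n →
      ∀ x, t (j + 1) ≤ x → lam j * g (q j x) + M j (q j x) = f (j + 1) := by
    intro j hj g hg1 hgn x hx
    rcases hcases j hj with ⟨h, e1, e2, m1, m2⟩ | ⟨h, e1, e2, m1, m2⟩
    · have : q j x = ⟨t n, right_mem_Icc.2 h1n.le⟩ :=
        projIcc_of_right_le _ ((le_div_iff₀ h).2 (by linarith))
      rw [this, hgn, m2]; ring
    · have : q j x = ⟨t 1, left_mem_Icc.2 h1n.le⟩ :=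
        projIcc_of_le_left _ ((div_le_iff_of_neg h).2 (by linarith))
      rw [this, hg1, m1]; ring
  obtain ⟨g, ⟨hg1, hgn, hg⟩, huniq⟩ := existsUnique_readBajraktarevic (by omega) hle h1n (q := q)
    (fun j _ => continuous_projIcc.comp (by fun_prop))
    (fun j hj => hlam j (hmem j hj).1 (hmem j hj).2)
    (fun j hj => hMcont j (hmem j hj).1 (hmem j hj).2) hleft hright
  have hφ : ∀ x (hx : x ∈ Icc (t 1) (t n)), IccExtend h1n.le g x = g ⟨x, hx⟩ := fun x hx =>
    IccExtend_of_mem _ _ hx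
  refine ⟨IccExtend h1n.le g, ⟨g.continuous.Icc_extend'.continuousOn, ?_, ?_, ?_⟩, ?_, ?_⟩
  · rw [hφ _ (left_mem_Icc.2 h1n.le), hg1]
  · rw [hφ _ (right_mem_Icc.2 h1n.le), hgn]
  · intro j h1 h2 s hs
    have hj := hmem' j h1 h2
    have hx := hLmem j hj s hs
    rw [hL j h1 h2, hφ _ (hsub j hj hx), hφ s hs, hg j hj _ hx, hqL j hj ⟨s, hs⟩]
  · rintro ψ ⟨hψc, hψ1, hψn, hψ⟩ x hx
    have hψg := huniq ⟨(Icc (t 1) (t n)).domRestrict ψ, hψc.domRestrict⟩ ⟨hψ1, hψn, fun j hj y hy => by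
      obtain ⟨h1, h2⟩ := hmem j hj
      have := hψ j h1 h2 (q j y) (q j y).2
      rwa [hL j h1 h2, hLq j hj y hy] at this⟩
    rw [hφ x hx, ← hψg]
    rfl
  · intro i h1 h2
    rcases h2.eq_or_lt with rfl | h2
    · rw [hφ _ (right_mem_Icc.2 h1n.le), hgn]
    · have hi := Finset.mem_Ico.2 ⟨h1, h2⟩
      have hx := left_mem_Icc.2 (hle i hi)
      rw [hφ _ (hsub i hi hx), hg i hi _ hx]
      exact hleft i hi g hg1 hgn _ le_rfl
end

section
/- Let a < b be real numbers and let L_1, ..., L_m : [a, b] → [a, b] be continuous maps whose images cover [a, b], i.e., ⋃_{j=1}^m L_j([a, b]) = [a, b]. Let λ_1, ..., λ_m ∈ ℝ with |λ_j| ≤ Λ for all j, where 0 ≤ Λ < 1, and let g_j, h_j : [a, b] → ℝ be continuous for each j. Suppose u, v : [a, b] → ℝ are continuous functions satisfying u(L_j(t)) = λ_j u(t) + g_j(t) and v(L_j(t)) = λ_j v(t) + h_j(t) for all t ∈ [a, b] and all j = 1, ..., m. Then ‖u − v‖_∞ ≤ (max_{1≤j≤m} ‖g_j − h_j‖_∞)/(1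 − Λ), where ‖·‖_∞ is the supremum norm on [a, b]. -/
open Set

/-- Stability estimate for self-referential functions: if `u` and
`v` satisfy self-referential equations with the same contraction maps `L j` and the
same scaling factors `λ j` (all bounded by `Λ < 1`) but with forcing terms `g j`
and `h j` respectively, then `‖u − v‖_∞ ≤ (max_j ‖g j − h j‖_∞) / (1 − Λ)`. -/
theorem self_referential_stability_estimate
    (a b : ℝ) (hab : a < b) (m : ℕ)
    (L : Fin m → ℝ → ℝ)
    (hLcont : ∀ j, ContinuousOn (L j) (Icc a b))
    (hLmaps : ∀ j, MapsTo (L j) (Icc a b) (Icc a b))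
    (hcover : (⋃ j, L j '' Icc a b) = Icc a b)
    (lam : Fin m → ℝ) (Λ : ℝ) (hΛ0 : 0 ≤ Λ) (hΛ1 : Λ < 1)
    (hlam : ∀ j, |lam j| ≤ Λ)
    (g h : Fin m → ℝ → ℝ)
    (hg : ∀ j, ContinuousOn (g j) (Icc a b))
    (hh : ∀ j, ContinuousOn (h j) (Icc a b))
    (u v : ℝ → ℝ)
    (hu : ContinuousOn u (Icc a b))
    (hv : ContinuousOn v (Icc a b))
    (hueq : ∀ j, ∀ s ∈ Icc a b, u (L j s) = lam j * u s + g j s)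
    (hveq : ∀ j, ∀ s ∈ Icc a b, v (L j s) = lam j * v s + h j s) :
    sSup ((fun s => |u s - v s|) '' Icc a b) ≤
      (⨆ j : Fin m, sSup ((fun s => |g j s - h j s|) '' Icc a b)) / (1 - Λ) := by
  obtain ⟨x, hx, hmax⟩ := isCompact_Icc.exists_isMaxOn (nonempty_Icc.2 hab.le) (hu.sub hv).abs
  have hx' := hx
  rw [← hcover] at hx'
  obtain ⟨j, s, hs, rfl⟩ := mem_iUnion.1 hx'
  have hgh : |g j s - h j s| ≤ ⨆ i : Fin m, sSup ((fun s => |g i s - h i s|) '' Icc a b) :=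
    (le_csSup (isCompact_Icc.image_of_continuousOn ((hg j).sub (hh j)).abs).bddAbove
      (mem_image_of_mem _ hs)).trans
      (le_ciSup (f := fun i => sSup ((fun s => |g i s - h i s|) '' Icc a b))
        (finite_range _).bddAbove j)
  have hle : |u s - v s| ≤ |u (L j s) - v (L j s)| := hmax hs
  have hstep : |u (L j s) - v (L j s)| ≤ Λ * |u (L j s) - v (L j s)| + |g j s - h j s| :=
    calc |u (L j s) - v (L j s)| = |lam j * (u s - v s) + (g j s - h j s)| := by
          rw [hueq j s hs, hveq j s hs]; ring_nf
      _ ≤ |lam j| * |u s - v s| + |g j s - h j s| := by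
          rw [← abs_mul]; exact abs_add_le _ _
      _ ≤ Λ * |u (L j s) - v (L j s)| + |g j s - h j s| := by
          gcongr
          exact hlam j
  refine csSup_le ((nonempty_Icc.2 hab.le).image _) ?_
  rintro _ ⟨t, ht, rfl⟩
  refine (show |u t - v t| ≤ |u (L j s) - v (L j s)| from hmax ht).trans ?_
  rw [le_div_iff₀ (by linarith)]
  linarith
end

section
/- Let a < b be real numbers and let L_1, ..., L_m : [a, b] → [a, b] be continuous maps whose images cover [a, b], i.e., ⋃_{j=1}^m L_j([a, b]) = [a, b]. Let λ_1, ..., λ_m ∈ ℝ with 0 ≤ λ_j < 1 for all j, and let R_j : [a, b] → ℝ be continuous with R_j(t) > 0 for all t ∈ [a, b] and each j. If φ : [a, b] → ℝ is a continuous function satisfying the self-referential equations φ(L_j(t)) = λ_j φ(t) + R_j(t) for all t ∈ [a, b] and all j = 1, ..., m, then φ(t) > 0 for all t ∈ [a, b]. -/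
open Set

/-- Positivity propagates through a self-referential functional
equation with nonnegative scaling factors `λ j < 1` and strictly positive forcing
terms `R j`. -/
theorem self_referential_positivity
    (a b : ℝ) (hab : a < b) (m : ℕ)
    (L : Fin m → ℝ → ℝ)
    (hLcont : ∀ j, ContinuousOn (L j) (Icc a b))
    (hLmaps : ∀ j, MapsTo (L j) (Icc a b) (Icc a b))
    (hcover : (⋃ j, L j '' Icc a b) = Icc a b)
    (lam : Fin m → ℝ)
    (hlam0 : ∀ j, 0 ≤ lam j) (hlam1 : ∀ j, lam j < 1)
    (R : Fin m → ℝ → ℝ)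
    (hRcont : ∀ j, ContinuousOn (R j) (Icc a b))
    (hRpos : ∀ j, ∀ s ∈ Icc a b, 0 < R j s)
    (φ : ℝ → ℝ)
    (hφcont : ContinuousOn φ (Icc a b))
    (hφeq : ∀ j, ∀ s ∈ Icc a b, φ (L j s) = lam j * φ s + R j s) :
    ∀ s ∈ Icc a b, 0 < φ s := by
  obtain ⟨x, hx, hmin⟩ := isCompact_Icc.exists_isMinOn (nonempty_Icc.2 hab.le) hφcont
  -- The minimum point `x` is some `L j t`, and the equation there forces `(1 - lam j) * φ x > 0`.
  obtain ⟨j, t, ht, rfl⟩ := mem_iUnion.1 (hcover.symm ▸ hx)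
  have hscale : lam j * φ (L j t) ≤ lam j * φ t :=
    mul_le_mul_of_nonneg_left (hmin ht) (hlam0 j)
  have hpos : 0 < φ (L j t) :=
    pos_of_mul_pos_right (a := 1 - lam j) (by linarith [hφeq j t ht, hRpos j t ht])
      (sub_nonneg.2 (hlam1 j).le)
  exact fun s hs => hpos.trans_le (hmin hs)
end

section
/- Let t_1 < t_n be real numbers, l = t_n − t_1, and θ(t) = (π/2)(t − t_1)/l for t ∈ [t_1, t_n]. Let a, λ, f_A, f_B, F_1, F_n, d_A, d_B, D_1, D_n be real numbers with a ≠ 0, and let α > 0, δ > 0, β ≥ 0, γ ≥ 0 be shape parameters. Set f* = f_A − λ F_1, f** = f_B − λ F_n, d* = a d_A − λ D_1, d** = a d_B − λ D_n, and define U = α f*, V = β f* + (2 l α / π) d*, W = γ f** − (2 l δ / π) d**, X = δ f**. For θ ∈ [0, π/2] let p(θ) = (1 − sin θ)^3 U + sin θ (1 − sin θ)^2 V + cos θ (1 − cos θ)^2 W + (1 − cos θ)^3 X and q(θ) = (1 − sin θ)^3 α + sin θ (1 − sin θ)^2 β + cos θ (1 − cos θ)^2 γ + (1 − cos θ)^3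 δ, and define M(t) = p(θ(t))/q(θ(t)) for t ∈ [t_1, t_n]. Then q(θ) > 0 on [0, π/2], M is continuously differentiable on [t_1, t_n], and M satisfies M(t_1) = f_A − λ F_1, M(t_n) = f_B − λ F_n, M'(t_1) = a d_A − λ D_1, and M'(t_n) = a d_B − λ D_n. -/
open Set Real

/-- The cubic trigonometric Bernstein-type combination with coefficients `A`, `B`, `C`, `D`. -/
noncomputable def cubicTrig (A B C D θ : ℝ) : ℝ :=
  (1 - sin θ) ^ 3 * A + sin θ * (1 - sin θ) ^ 2 * B +
    cos θ * (1 - cos θ) ^ 2 * C + (1 - cos θ) ^ 3 * D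

lemma contDiff_cubicTrig (A B C D : ℝ) {n : WithTop ℕ∞} : ContDiff ℝ n (cubicTrig A B C D) := by
  unfold cubicTrig
  fun_prop

lemma cubicTrig_zero (A B C D : ℝ) : cubicTrig A B C D 0 = A := by
  simp [cubicTrig]

lemma cubicTrig_pi_div_two (A B C D : ℝ) : cubicTrig A B C D (π / 2) = D := by
  simp [cubicTrig]

lemma hasDerivAt_cubicTrig (A B C D θ : ℝ) :
    HasDerivAt (cubicTrig A B C D)
      (-3 * (1 - sin θ) ^ 2 * cos θ * A
        + (cos θ * (1 - sin θ) ^ 2 - 2 * sin θ * (1 - sin θ) * cos θ) * B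
        + (-sin θ * (1 - cos θ) ^ 2 + 2 * cos θ * (1 - cos θ) * sin θ) * C
        + 3 * (1 - cos θ) ^ 2 * sin θ * D) θ := by
  have hs := hasDerivAt_sin θ
  have hc := hasDerivAt_cos θ
  have hs' := hs.const_sub 1
  have hc' := hc.const_sub 1
  have key := ((((hs'.pow 3).mul_const A).add ((hs.mul (hs'.pow 2)).mul_const B)).add
    ((hc.mul (hc'.pow 2)).mul_const C)).add ((hc'.pow 3).mul_const D)
  refine HasDerivAt.congr_deriv (f := cubicTrig A B C D) key ?_
  simp only [Pi.pow_apply]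
  push_cast
  ring

lemma hasDerivAt_cubicTrig_zero (A B C D : ℝ) :
    HasDerivAt (cubicTrig A B C D) (B - 3 * A) 0 := by
  convert hasDerivAt_cubicTrig A B C D 0 using 1
  simp only [sin_zero, cos_zero]
  ring

lemma hasDerivAt_cubicTrig_pi_div_two (A B C D : ℝ) :
    HasDerivAt (cubicTrig A B C D) (3 * D - C) (π / 2) := by
  convert hasDerivAt_cubicTrig A B C D (π / 2) using 1
  simp only [sin_pi_div_two, cos_pi_div_two]
  ring

lemma cubicTrig_pos {A B C D θ : ℝ} (hA : 0 < A) (hB : 0 ≤ B) (hC : 0 ≤ C) (hD : 0 < D)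
    (hθ : θ ∈ Icc (0 : ℝ) (π / 2)) : 0 < cubicTrig A B C D θ := by
  have hs : 0 ≤ sin θ := sin_nonneg_of_nonneg_of_le_pi hθ.1 (by linarith [hθ.2, pi_pos])
  have hc : 0 ≤ cos θ := cos_nonneg_of_neg_pi_div_two_le_of_le (by linarith [hθ.1, pi_pos]) hθ.2
  have hs1 : 0 ≤ 1 - sin θ := sub_nonneg.2 (sin_le_one θ)
  have hc1 : 0 ≤ 1 - cos θ := sub_nonneg.2 (cos_le_one θ)
  unfold cubicTrig
  rcases hs1.eq_or_lt with h0 | h0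
  · have hc0 : cos θ = 0 := by
      have := sin_sq_add_cos_sq θ
      rw [show sin θ = 1 by linarith] at this
      exact pow_eq_zero_iff two_ne_zero |>.1 (by linarith)
    rw [← h0, hc0]
    simpa using hD
  · positivity

/-- The rational cubic trigonometric function `M = p∘θ / q∘θ` has
a strictly positive denominator on `[0, π/2]`, is continuously differentiable on
`[t₁, tₙ]`, and attains the prescribed function and first-derivative values at the
two endpoints. -/
theorem rational_cubic_trig_endpoint_conditions
    (t1 tn : ℝ) (h : t1 < tn)
    (a lam fA fB F1 Fn dA dB D1 Dn : ℝ) (ha : a ≠ 0)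
    (α δ β γ : ℝ) (hα : 0 < α) (hδ : 0 < δ) (hβ : 0 ≤ β) (hγ : 0 ≤ γ)
    (l fs fss ds dss U V W X : ℝ)
    (hl : l = tn - t1)
    (hfs : fs = fA - lam * F1)
    (hfss : fss = fB - lam * Fn)
    (hds : ds = a * dA - lam * D1)
    (hdss : dss = a * dB - lam * Dn)
    (hU : U = α * fs)
    (hV : V = β * fs + (2 * l * α / π) * ds)
    (hW : W = γ * fss - (2 * l * δ / π) * dss)
    (hX : X = δ * fss)
    (p q : ℝ → ℝ)
    (hp : ∀ θ : ℝ, p θ = (1 - sin θ) ^ 3 * U + sin θ * (1 - sin θ) ^ 2 * V +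
      cos θ * (1 - cos θ) ^ 2 * W + (1 - cos θ) ^ 3 * X)
    (hq : ∀ θ : ℝ, q θ = (1 - sin θ) ^ 3 * α + sin θ * (1 - sin θ) ^ 2 * β +
      cos θ * (1 - cos θ) ^ 2 * γ + (1 - cos θ) ^ 3 * δ)
    (θf : ℝ → ℝ) (hθf : ∀ s : ℝ, θf s = (π / 2) * (s - t1) / l)
    (M : ℝ → ℝ) (hM : ∀ s : ℝ, M s = p (θf s) / q (θf s)) :
    (∀ θ ∈ Icc (0 : ℝ) (π / 2), 0 < q θ) ∧
    ContDiffOn ℝ 1 M (Icc t1 tn) ∧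
    M t1 = fA - lam * F1 ∧
    M tn = fB - lam * Fn ∧
    derivWithin M (Icc t1 tn) t1 = a * dA - lam * D1 ∧
    derivWithin M (Icc t1 tn) tn = a * dB - lam * Dn := by
  have hl0 : l ≠ 0 := by rw [hl]; exact (sub_pos.2 h).ne'
  have hlpos : 0 < l := by rw [hl]; exact sub_pos.2 h
  have hπ := pi_ne_zero
  obtain rfl : p = cubicTrig U V W X := funext hp
  obtain rfl : q = cubicTrig α β γ δ := funext hq
  obtain rfl : M = fun s => cubicTrig U V W X (θf s) / cubicTrig α β γ δ (θf s) := funext hM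
  have hpos : ∀ θ ∈ Icc (0 : ℝ) (π / 2), 0 < cubicTrig α β γ δ θ :=
    fun θ hθ => cubicTrig_pos hα hβ hγ hδ hθ
  have hθ1 : θf t1 = 0 := by simp [hθf]
  have hθn : θf tn = π / 2 := by rw [hθf, ← hl]; field_simp
  have hθ_mem : ∀ s ∈ Icc t1 tn, θf s ∈ Icc (0 : ℝ) (π / 2) := by
    intro s hs
    have h1 : 0 ≤ s - t1 := sub_nonneg.2 hs.1
    rw [hθf]
    refine ⟨by positivity, ?_⟩
    rw [div_le_iff₀ hlpos]
    exact mul_le_mul_of_nonneg_left (by linarith [hs.2]) (by positivity)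
  have hθ_smooth : ContDiff ℝ 1 θf := by
    rw [funext hθf]
    fun_prop
  have hθ_deriv : ∀ s, HasDerivAt θf (π / 2 / l) s := by
    intro s
    rw [funext hθf]
    simpa using (((hasDerivAt_id s).sub_const t1).const_mul (π / 2)).div_const l
  have hunique := uniqueDiffOn_Icc h
  refine ⟨hpos, ?_, ?_, ?_, ?_, ?_⟩
  · exact ((contDiff_cubicTrig U V W X).comp hθ_smooth).contDiffOn.div
      ((contDiff_cubicTrig α β γ δ).comp hθ_smooth).contDiffOn
      fun s hs => (hpos _ (hθ_mem s hs)).ne'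
  · simp only [hθ1, cubicTrig_zero]
    rw [hU, ← hfs]
    field_simp
  · simp only [hθn, cubicTrig_pi_div_two]
    rw [hX, ← hfss]
    field_simp
  · have hP := (hθ1 ▸ hasDerivAt_cubicTrig_zero U V W X :
      HasDerivAt (cubicTrig U V W X) (V - 3 * U) (θf t1)).comp t1 (hθ_deriv t1)
    have hQ := (hθ1 ▸ hasDerivAt_cubicTrig_zero α β γ δ :
      HasDerivAt (cubicTrig α β γ δ) (β - 3 * α) (θf t1)).comp t1 (hθ_deriv t1)
    have hne : (cubicTrig α β γ δ ∘ θf) t1 ≠ 0 := by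
      simpa [hθ1, cubicTrig_zero] using hα.ne'
    refine ((hP.div hQ hne).hasDerivWithinAt.derivWithin
      (hunique t1 (left_mem_Icc.2 h.le))).trans ?_
    simp only [Function.comp_apply, hθ1, cubicTrig_zero]
    rw [← hds, hV, hU]
    field_simp
    ring
  · have hP := (hθn ▸ hasDerivAt_cubicTrig_pi_div_two U V W X :
      HasDerivAt (cubicTrig U V W X) (3 * X - W) (θf tn)).comp tn (hθ_deriv tn)
    have hQ := (hθn ▸ hasDerivAt_cubicTrig_pi_div_two α β γ δ :
      HasDerivAt (cubicTrig α β γ δ) (3 * δ - γ) (θf tn)).comp tn (hθ_deriv tn)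
    have hne : (cubicTrig α β γ δ ∘ θf) tn ≠ 0 := by
      simpa [hθn, cubicTrig_pi_div_two] using hδ.ne'
    refine ((hP.div hQ hne).hasDerivWithinAt.derivWithin
      (hunique tn (right_mem_Icc.2 h.le))).trans ?_
    simp only [Function.comp_apply, hθn, cubicTrig_pi_div_two]
    rw [← hdss, hW, hX]
    field_simp
    ring
end

section
/- Let t_1 < t_2 < ... < t_n be real numbers (n ≥ 3) with data values f_1, ..., f_n ∈ ℝ and derivative values d_1, ..., d_n ∈ ℝ, let ε = (ε_1, ..., ε_{n−1}) ∈ {0,1}^{n−1} be a signature, l = t_n − t_1, and θ(t) = (π/2)(t − t_1)/l. For j = 1, ..., n−1 set a_j = (t_{j+1−ε_j} − t_{j+ε_j})/(t_n − t_1), b_j = (t_n t_{j+ε_j} − t_1 t_{j+1−ε_j})/(t_n − t_1), L_{j,ε}(t) = a_j t + b_j. Let λ_j ∈ ℝ with |λ_j| < 1, and let shape parameters satisfy α_j > 0, δ_j > 0, β_j ≥ 0, γ_j ≥ 0. Define f_j* = f_{j+ε_j} − λ_j f_1, f_{j+1}* = f_{j+1−ε_j} − λ_j f_n, d_j* = a_j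 d_{j+ε_j} − λ_j d_1, d_{j+1}* = a_j d_{j+1−ε_j} − λ_j d_n, U_j = α_j f_j*, V_j = β_j f_j* + (2 l α_j/π) d_j*, W_j = γ_j f_{j+1}* − (2 l δ_j/π) d_{j+1}*, X_j = δ_j f_{j+1}*, p_j(θ) = (1 − sin θ)^3 U_j + sin θ (1 − sin θ)^2 V_j + cos θ (1 − cos θ)^2 W_j + (1 − cos θ)^3 X_j, q_j(θ) = (1 − sin θ)^3 α_j + sin θ (1 − sin θ)^2 β_j + cos θ (1 − cos θ)^2 γ_j + (1 − cos θ)^3 δ_j, and M_{j,ε}(t) = p_j(θ(t))/q_j(θ(t)). Then there exists a unique continuous function φ_ε : [t_1, t_n] → ℝ with φ_ε(t_1) = f_1 and φ_ε(t_n) = f_n satisfying φ_ε(L_{j,ε}(t)) = λ_j φ_ε(t) + M_{j,ε}(t) for all t ∈ [t_1, t_n] and all j, and this function satisfies φ_ε(t_i) = f_i for every i = 1, ..., n. -/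
open Set Real

section ReadBajraktarevic

variable {X ι : Type*} [TopologicalSpace X] [CompactSpace X]

/-- Two continuous solutions of the same Read–Bajraktarević self-referential equation agree. -/
theorem selfReferential_unique {L : ι → X → X} (hsurj : ∀ x, ∃ i y, L i y = x)
    {lam : ι → ℝ} (hlam : ∀ i, |lam i| < 1) {M : ι → X → ℝ} {φ ψ : C(X, ℝ)}
    (hφ : ∀ i x, φ (L i x) = lam i * φ x + M i x)
    (hψ : ∀ i x, ψ (L i x) = lam i * ψ x + M i x) : ψ = φ := by
  ext x
  have : Nonempty X := ⟨x⟩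
  obtain ⟨z, -, hz⟩ := isCompact_univ.exists_isMaxOn univ_nonempty
    (f := fun y => |ψ y - φ y|) (by fun_prop)
  obtain ⟨i, y, rfl⟩ := hsurj z
  have hy : |ψ y - φ y| ≤ |ψ (L i y) - φ (L i y)| := hz (mem_univ y)
  have hx : |ψ x - φ x| ≤ |ψ (L i y) - φ (L i y)| := hz (mem_univ x)
  have heq : |ψ (L i y) - φ (L i y)| = |lam i| * |ψ y - φ y| := by
    rw [hφ, hψ, ← abs_mul]
    congr 1
    ring
  have h0 : |ψ y - φ y| ≤ 0 := by
    nlinarith [hlam i, abs_nonneg (ψ y - φ y)]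
  have h0' : |ψ y - φ y| = 0 := le_antisymm h0 (abs_nonneg _)
  rw [heq, h0', mul_zero] at hx
  exact sub_eq_zero.1 (abs_nonpos_iff.1 hx)

/-- Existence of a continuous solution of a Read–Bajraktarević self-referential equation inside a
closed set of functions on which the pieces of the operator are compatible. -/
theorem selfReferential_exists [T2Space X] [Finite ι] (L : ι → C(X, X))
    (hsurj : ∀ x, ∃ i y, L i y = x)
    (lam : ι → ℝ) (hlam : ∀ i, |lam i| < 1) (M : ι → C(X, ℝ))
    (S : Set C(X, ℝ)) (hS : IsClosed S) (hne : S.Nonempty)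
    (hcompat : ∀ g ∈ S, ∀ i j x y, L i x = L j y →
      lam i * g x + M i x = lam j * g y + M j y)
    (hmaps : ∀ g ∈ S, ∀ h : C(X, ℝ),
      (∀ i x, h (L i x) = lam i * g x + M i x) → h ∈ S) :
    ∃ φ ∈ S, ∀ i x, φ (L i x) = lam i * φ x + M i x := by
  have hquot : Topology.IsQuotientMap (fun p : Σ _ : ι, X => L p.1 p.2) := by
    refine Topology.IsQuotientMap.of_surjective_continuous ?_ ?_
    · intro x
      obtain ⟨i, y, h⟩ := hsurj x
      exact ⟨⟨i, y⟩, h⟩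
    · exact continuous_sigma fun i => (L i).continuous
  have hlift : ∀ g : S, ∃ h : S, ∀ i x, h.1 (L i x) = lam i * g.1 x + M i x := by
    rintro ⟨g, hg⟩
    let G : C(Σ _ : ι, X, ℝ) := ⟨fun p => lam p.1 * g p.2 + M p.1 p.2,
      continuous_sigma fun i => by fun_prop⟩
    have hfac : Function.FactorsThrough G (fun p : Σ _ : ι, X => L p.1 p.2) :=
      fun p r h => hcompat g hg p.1 r.1 p.2 r.2 h
    let F : C(Σ _ : ι, X, X) := ⟨_, hquot.continuous⟩
    let h : C(X, ℝ) := Topology.IsQuotientMap.lift (f := F) hquot G hfac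
    have hh : ∀ i x, h (L i x) = lam i * g x + M i x := fun i x =>
      DFunLike.congr_fun (Topology.IsQuotientMap.lift_comp (f := F) hquot G hfac) ⟨i, x⟩
    exact ⟨⟨h, hmaps g hg h hh⟩, hh⟩
  choose T hT using hlift
  obtain ⟨K, hK0, hK1, hK⟩ : ∃ K : ℝ, 0 ≤ K ∧ K < 1 ∧ ∀ i, |lam i| ≤ K := by
    rcases isEmpty_or_nonempty ι with h | h
    · exact ⟨0, le_rfl, one_pos, fun i => h.elim i⟩
    · obtain ⟨i, hi⟩ := Finite.exists_max fun i => |lam i|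
      exact ⟨|lam i|, abs_nonneg _, hlam i, hi⟩
  have hcontr : ContractingWith ⟨K, hK0⟩ T := by
    refine ⟨by exact_mod_cast hK1, LipschitzWith.of_dist_le_mul fun g h => ?_⟩
    change dist (T g).1 (T h).1 ≤ K * dist g.1 h.1
    rw [ContinuousMap.dist_le (by positivity)]
    intro x
    obtain ⟨i, y, rfl⟩ := hsurj x
    rw [hT, hT, dist_add_right, Real.dist_eq, ← mul_sub, abs_mul, ← Real.dist_eq]
    exact mul_le_mul (hK i) (ContinuousMap.dist_apply_le_dist y) dist_nonneg hK0
  have : CompleteSpace S := hS.completeSpace_coe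
  have : Nonempty S := hne.to_subtype
  have hfix := hcontr.fixedPoint_isFixedPt
  refine ⟨(hcontr.fixedPoint T).1, (hcontr.fixedPoint T).2, fun i x => ?_⟩
  have h := hT (hcontr.fixedPoint T) i x
  rwa [hfix] at h

end ReadBajraktarevic

/-- The denominator of a rational cubic trigonometric spline is positive on `[0, π / 2]`. -/
theorem cubicTrig_denominator_pos {α β γ δ θ : ℝ} (hα : 0 < α) (hδ : 0 < δ) (hβ : 0 ≤ β)
    (hγ : 0 ≤ γ) (hθ : θ ∈ Icc 0 (π / 2)) :
    0 < (1 - sin θ) ^ 3 * α + sin θ * (1 - sin θ) ^ 2 * β +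
        cos θ * (1 - cos θ) ^ 2 * γ + (1 - cos θ) ^ 3 * δ := by
  have hs : 0 ≤ sin θ := sin_nonneg_of_nonneg_of_le_pi hθ.1 (by linarith [hθ.2, pi_pos])
  have hc : 0 ≤ cos θ := cos_nonneg_of_neg_pi_div_two_le_of_le (by linarith [hθ.1, pi_pos]) hθ.2
  have hs1 : 0 ≤ 1 - sin θ := sub_nonneg.2 (sin_le_one θ)
  have hc1 : 0 ≤ 1 - cos θ := sub_nonneg.2 (cos_le_one θ)
  rcases hs1.eq_or_lt with h | h
  · have hcos : cos θ = 0 := by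
      have := sin_sq_add_cos_sq θ
      rw [show sin θ = 1 by linarith] at this
      nlinarith
    rw [← h, hcos]
    simpa using hδ
  · positivity

/-- A point between the first and the last of finitely many nodes lies between two consecutive
nodes. -/
theorem exists_mem_Icc_succ_s8 {t : ℕ → ℝ} {x : ℝ} {n : ℕ} (hn : 2 ≤ n)
    (hx : x ∈ Icc (t 1) (t n)) : ∃ j, 1 ≤ j ∧ j ≤ n - 1 ∧ x ∈ Icc (t j) (t (j + 1)) := by
  induction n, hn using Nat.le_induction with
  | base => exact ⟨1, le_rfl, le_rfl, hx⟩
  | succ m hm ih =>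
    rcases le_total x (t m) with h | h
    · obtain ⟨j, h1, h2, h3⟩ := ih ⟨hx.1, h⟩
      exact ⟨j, h1, by omega, h3⟩
    · exact ⟨m, by omega, by omega, h, hx.2⟩

/-- Existence, uniqueness and interpolation property of the
rational cubic trigonometric zipper fractal interpolation function (RCTZFIF). -/
theorem RCTZFIF_exists_unique_and_interpolates
    (n : ℕ) (hn : 3 ≤ n)
    (t f d : ℕ → ℝ)
    (ht : ∀ i, 1 ≤ i → i ≤ n - 1 → t i < t (i + 1))
    (ε : ℕ → ℕ) (hε : ∀ j, 1 ≤ j → j ≤ n - 1 → ε j = 0 ∨ ε j = 1)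
    (l : ℝ) (hl : l = t n - t 1)
    (θf : ℝ → ℝ) (hθf : ∀ s : ℝ, θf s = (π / 2) * (s - t 1) / l)
    (a b : ℕ → ℝ)
    (ha : ∀ j, 1 ≤ j → j ≤ n - 1 →
      a j = (t (j + 1 - ε j) - t (j + ε j)) / (t n - t 1))
    (hb : ∀ j, 1 ≤ j → j ≤ n - 1 →
      b j = (t n * t (j + ε j) - t 1 * t (j + 1 - ε j)) / (t n - t 1))
    (L : ℕ → ℝ → ℝ)
    (hL : ∀ j, 1 ≤ j → j ≤ n - 1 → ∀ s : ℝ, L j s = a j * s + b j)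
    (lam : ℕ → ℝ)
    (hlam : ∀ j, 1 ≤ j → j ≤ n - 1 → |lam j| < 1)
    (α β γ δ : ℕ → ℝ)
    (hα : ∀ j, 1 ≤ j → j ≤ n - 1 → 0 < α j)
    (hδ : ∀ j, 1 ≤ j → j ≤ n - 1 → 0 < δ j)
    (hβ : ∀ j, 1 ≤ j → j ≤ n - 1 → 0 ≤ β j)
    (hγ : ∀ j, 1 ≤ j → j ≤ n - 1 → 0 ≤ γ j)
    (fs fss ds dss U V W X : ℕ → ℝ)
    (hfs : ∀ j, 1 ≤ j → j ≤ n - 1 → fs j = f (j + ε j) - lam j * f 1)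
    (hfss : ∀ j, 1 ≤ j → j ≤ n - 1 → fss j = f (j + 1 - ε j) - lam j * f n)
    (hds : ∀ j, 1 ≤ j → j ≤ n - 1 → ds j = a j * d (j + ε j) - lam j * d 1)
    (hdss : ∀ j, 1 ≤ j → j ≤ n - 1 → dss j = a j * d (j + 1 - ε j) - lam j * d n)
    (hU : ∀ j, 1 ≤ j → j ≤ n - 1 → U j = α j * fs j)
    (hV : ∀ j, 1 ≤ j → j ≤ n - 1 → V j = β j * fs j + (2 * l * α j / π) * ds j)
    (hW : ∀ j, 1 ≤ j → j ≤ n - 1 → W j = γ j * fss j - (2 * l * δ j / π) * dss j)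
    (hX : ∀ j, 1 ≤ j → j ≤ n - 1 → X j = δ j * fss j)
    (p q : ℕ → ℝ → ℝ)
    (hp : ∀ j, 1 ≤ j → j ≤ n - 1 → ∀ θ : ℝ,
      p j θ = (1 - sin θ) ^ 3 * U j + sin θ * (1 - sin θ) ^ 2 * V j +
        cos θ * (1 - cos θ) ^ 2 * W j + (1 - cos θ) ^ 3 * X j)
    (hq : ∀ j, 1 ≤ j → j ≤ n - 1 → ∀ θ : ℝ,
      q j θ = (1 - sin θ) ^ 3 * α j + sin θ * (1 - sin θ) ^ 2 * β j +
        cos θ * (1 - cos θ) ^ 2 * γ j + (1 - cos θ) ^ 3 * δ j)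
    (M : ℕ → ℝ → ℝ)
    (hM : ∀ j, 1 ≤ j → j ≤ n - 1 → ∀ s : ℝ, M j s = p j (θf s) / q j (θf s)) :
    ∃ φ : ℝ → ℝ,
      (ContinuousOn φ (Icc (t 1) (t n)) ∧
        φ (t 1) = f 1 ∧ φ (t n) = f n ∧
        ∀ j, 1 ≤ j → j ≤ n - 1 → ∀ s ∈ Icc (t 1) (t n),
          φ (L j s) = lam j * φ s + M j s) ∧
      -- uniqueness (as functions on `[t 1, t n]`)
      (∀ ψ : ℝ → ℝ,
        (ContinuousOn ψ (Icc (t 1) (t n)) ∧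
          ψ (t 1) = f 1 ∧ ψ (t n) = f n ∧
          ∀ j, 1 ≤ j → j ≤ n - 1 → ∀ s ∈ Icc (t 1) (t n),
            ψ (L j s) = lam j * ψ s + M j s) →
        EqOn ψ φ (Icc (t 1) (t n))) ∧
      -- interpolation of the data
      (∀ i, 1 ≤ i → i ≤ n → φ (t i) = f i) := by
  have hmono : ∀ i k, 1 ≤ i → i < k → k ≤ n → t i < t k := by
    intro i k hi hik hk
    induction k, hik using Nat.le_induction with
    | base => exact ht i hi (by omega)
    | succ m hm ih => exact (ih (by omega)).trans (ht m (by omega) (by omega))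
  have hmono' : ∀ i k, 1 ≤ i → i ≤ k → k ≤ n → t i ≤ t k := by
    intro i k hi hik hk
    rcases hik.eq_or_lt with rfl | h
    · exact le_rfl
    · exact (hmono i k hi h hk).le
  have h1n : t 1 < t n := hmono 1 n le_rfl (by omega) le_rfl
  have hl0 : 0 < l := by linarith
  have hln : t n - t 1 ≠ 0 := by linarith
  have hθ1 : θf (t 1) = 0 := by simp [hθf]
  have hθn : θf (t n) = π / 2 := by rw [hθf, ← hl]; field_simp
  have hθmem : ∀ s ∈ Icc (t 1) (t n), θf s ∈ Icc 0 (π / 2) := by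
    intro s hs
    rw [hθf]
    have hpi := pi_pos
    refine ⟨div_nonneg (mul_nonneg (by positivity) (by linarith [hs.1])) hl0.le, ?_⟩
    rw [div_le_iff₀ hl0]
    exact mul_le_mul_of_nonneg_left (by linarith [hs.2]) (by positivity)
  have hM1 : ∀ j, 1 ≤ j → j ≤ n - 1 → f (j + ε j) = lam j * f 1 + M j (t 1) := by
    intro j h1 h2
    have hne := (hα j h1 h2).ne'
    rw [hM j h1 h2, hθ1, hp j h1 h2, hq j h1 h2, hU j h1 h2, hfs j h1 h2]
    simp [hne]
  have hMn : ∀ j, 1 ≤ j → j ≤ n - 1 → f (j + 1 - ε j) = lam j * f n + M j (t n) := by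
    intro j h1 h2
    have hne := (hδ j h1 h2).ne'
    rw [hM j h1 h2, hθn, hp j h1 h2, hq j h1 h2, hX j h1 h2, hfss j h1 h2]
    simp [hne]
  have hMcont : ∀ j, 1 ≤ j → j ≤ n - 1 → ContinuousOn (M j) (Icc (t 1) (t n)) := by
    intro j h1 h2
    have hθc : Continuous θf := by
      rw [funext hθf]
      fun_prop
    rw [funext (hM j h1 h2)]
    refine ContinuousOn.div ?_ ?_ fun s hs => ?_
    · simp only [hp j h1 h2]
      fun_prop
    · simp only [hq j h1 h2]
      fun_prop
    · rw [hq j h1 h2]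
      exact (cubicTrig_denominator_pos (hα j h1 h2) (hδ j h1 h2) (hβ j h1 h2) (hγ j h1 h2)
        (hθmem s hs)).ne'
  have hL1 : ∀ j, 1 ≤ j → j ≤ n - 1 → L j (t 1) = t (j + ε j) := by
    intro j h1 h2
    rw [hL j h1 h2, ha j h1 h2, hb j h1 h2]
    field_simp
    ring
  have hLn : ∀ j, 1 ≤ j → j ≤ n - 1 → L j (t n) = t (j + 1 - ε j) := by
    intro j h1 h2
    rw [hL j h1 h2, ha j h1 h2, hb j h1 h2]
    field_simp
    ring
  have hLcont : ∀ j, 1 ≤ j → j ≤ n - 1 → Continuous (L j) := by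
    intro j h1 h2
    rw [funext (hL j h1 h2)]
    fun_prop
  have hLinj : ∀ j, 1 ≤ j → j ≤ n - 1 → Function.Injective (L j) := by
    intro j h1 h2 s s' h
    have ha0 : a j ≠ 0 := by
      rw [ha j h1 h2]
      refine div_ne_zero ?_ hln
      have := ht j h1 h2
      rcases hε j h1 h2 with h | h <;> simp only [h, add_zero, Nat.sub_zero, Nat.add_sub_cancel]
      · exact sub_ne_zero.2 this.ne'
      · exact sub_ne_zero.2 this.ne
    rw [hL j h1 h2, hL j h1 h2] at h
    exact mul_left_cancel₀ ha0 (add_right_cancel h)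
  have hLmem : ∀ j, 1 ≤ j → j ≤ n - 1 → ∀ s ∈ Icc (t 1) (t n),
      L j s ∈ Icc (t j) (t (j + 1)) := by
    intro j h1 h2 s hs
    have hseg : L j s ∈ uIcc (L j (t 1)) (L j (t n)) := by
      rw [hL j h1 h2, hL j h1 h2, hL j h1 h2, mem_uIcc]
      rcases le_total 0 (a j) with h | h
      · left
        constructor <;> nlinarith [hs.1, hs.2]
      · right
        constructor <;> nlinarith [hs.1, hs.2]
    rw [hL1 j h1 h2, hLn j h1 h2] at hseg
    have := (ht j h1 h2).le
    rcases hε j h1 h2 with h | h <;>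
      simp only [h, add_zero, Nat.sub_zero, Nat.add_sub_cancel] at hseg
    · rwa [uIcc_of_le this] at hseg
    · rwa [uIcc_of_ge this] at hseg
  have hLsurj : ∀ j, 1 ≤ j → j ≤ n - 1 → ∀ x ∈ Icc (t j) (t (j + 1)),
      ∃ s ∈ Icc (t 1) (t n), L j s = x := by
    intro j h1 h2 x hx
    have hivt := intermediate_value_uIcc (hLcont j h1 h2).continuousOn (a := t 1) (b := t n)
    rw [hL1 j h1 h2, hLn j h1 h2, uIcc_of_le h1n.le] at hivt
    apply hivt
    have := (ht j h1 h2).le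
    rcases hε j h1 h2 with h | h <;> simp only [h, add_zero, Nat.sub_zero, Nat.add_sub_cancel]
    · rwa [uIcc_of_le this]
    · rwa [uIcc_of_ge this]
  have hLsub : ∀ j, 1 ≤ j → j ≤ n - 1 → ∀ s ∈ Icc (t 1) (t n), L j s ∈ Icc (t 1) (t n) :=
    fun j h1 h2 s hs => Icc_subset_Icc (hmono' 1 j le_rfl h1 (by omega))
      (hmono' (j + 1) n (by omega) (by omega) le_rfl) (hLmem j h1 h2 s hs)
  -- A preimage of a node is an end point, where the equation prescribes the data value.
  have hnode : ∀ j, 1 ≤ j → j ≤ n - 1 → ∀ i, i = j ∨ i = j + 1 → ∀ s, L j s = t i →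
      ∀ g : ℝ → ℝ, g (t 1) = f 1 → g (t n) = f n → lam j * g s + M j s = f i := by
    intro j h1 h2 i hi s hs g hg1 hgn
    have hi' : i = j + ε j ∨ i = j + 1 - ε j := by
      rcases hε j h1 h2 with h | h <;> omega
    rcases hi' with rfl | rfl
    · rw [← hL1 j h1 h2] at hs
      rw [hLinj j h1 h2 hs, hg1, hM1 j h1 h2]
    · rw [← hLn j h1 h2] at hs
      rw [hLinj j h1 h2 hs, hgn, hMn j h1 h2]
  have hdata : ∀ g h : ℝ → ℝ, g (t 1) = f 1 → g (t n) = f n →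
      (∀ j, 1 ≤ j → j ≤ n - 1 → ∀ s ∈ Icc (t 1) (t n), h (L j s) = lam j * g s + M j s) →
      ∀ i, 1 ≤ i → i ≤ n → h (t i) = f i := by
    intro g h hg1 hgn hh i hi hin
    obtain ⟨j, h1, h2, hij⟩ : ∃ j, 1 ≤ j ∧ j ≤ n - 1 ∧ (i = j ∨ i = j + 1) := by
      rcases hin.eq_or_lt with rfl | hlt
      · exact ⟨i - 1, by omega, by omega, by omega⟩
      · exact ⟨i, hi, by omega, Or.inl rfl⟩
    have hmem : t i ∈ Icc (t j) (t (j + 1)) :=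
      ⟨hmono' j i h1 (by omega) hin, hmono' i (j + 1) hi (by omega) (by omega)⟩
    obtain ⟨s, hs, hsi⟩ := hLsurj j h1 h2 _ hmem
    rw [← hsi, hh j h1 h2 s hs, hnode j h1 h2 i hij s hsi g hg1 hgn]
  have hglue : ∀ g : ℝ → ℝ, g (t 1) = f 1 → g (t n) = f n →
      ∀ j k, 1 ≤ j → j ≤ k → k ≤ n - 1 → ∀ s ∈ Icc (t 1) (t n), ∀ s' ∈ Icc (t 1) (t n),
      L j s = L k s' → lam j * g s + M j s = lam k * g s' + M k s' := by
    intro g hg1 hgn j k h1 hjk h2 s hs s' hs' h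
    rcases hjk.eq_or_lt with rfl | hlt
    · rw [hLinj j h1 h2 h]
    · have hj := hLmem j h1 (by omega) s hs
      have hk := hLmem k (by omega) h2 s' hs'
      have hle : t (j + 1) ≤ t k := hmono' _ _ (by omega) hlt (by omega)
      have e1 : L j s = t (j + 1) := le_antisymm hj.2 (by rw [h]; exact hle.trans hk.1)
      have e2 : L k s' = t k := le_antisymm (by rw [← h]; exact hj.2.trans hle) hk.1
      have hkj : k = j + 1 := by
        by_contra hne
        have := hmono (j + 1) k (by omega) (by omega) (by omega)
        rw [← e1, ← e2, h] at this
        exact lt_irrefl _ this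
      rw [hnode j h1 (by omega) (j + 1) (Or.inr rfl) s e1 g hg1 hgn,
        hnode k (by omega) h2 k (Or.inl rfl) s' e2 g hg1 hgn, hkj]
  let I := Icc (t 1) (t n)
  let ι := Icc 1 (n - 1)
  let x₁ : I := ⟨t 1, left_mem_Icc.2 h1n.le⟩
  let xₙ : I := ⟨t n, right_mem_Icc.2 h1n.le⟩
  let LI : ι → C(I, I) := fun j => ⟨fun s => ⟨L j s, hLsub j j.2.1 j.2.2 s s.2⟩,
    ((hLcont j j.2.1 j.2.2).comp continuous_subtype_val).subtype_mk _⟩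
  let MI : ι → C(I, ℝ) := fun j => ⟨fun s => M j s, (hMcont j j.2.1 j.2.2).domRestrict⟩
  let S : Set C(I, ℝ) := {g | g x₁ = f 1 ∧ g xₙ = f n}
  have hsurj : ∀ x : I, ∃ j y, LI j y = x := by
    intro x
    obtain ⟨j, h1, h2, hx⟩ := exists_mem_Icc_succ_s8 (by omega) x.2
    obtain ⟨s, hs, hsx⟩ := hLsurj j h1 h2 _ hx
    exact ⟨⟨j, h1, h2⟩, ⟨s, hs⟩, Subtype.ext hsx⟩
  have hext : ∀ g : C(I, ℝ), ∀ s (hs : s ∈ I), IccExtend h1n.le g s = g ⟨s, hs⟩ :=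
    fun g s hs => IccExtend_of_mem h1n.le g hs
  have hSclosed : IsClosed S :=
    (isClosed_eq (continuous_eval_const x₁) continuous_const).inter
      (isClosed_eq (continuous_eval_const xₙ) continuous_const)
  have hSne : S.Nonempty := by
    refine ⟨⟨fun s => f 1 + (f n - f 1) * ((s - t 1) / (t n - t 1)), by fun_prop⟩, ?_, ?_⟩
    · simp [x₁]
    · simp [xₙ, div_self hln]
  obtain ⟨φ, hφS, hφ⟩ := selfReferential_exists LI hsurj (fun j => lam j)
    (fun j => hlam j j.2.1 j.2.2) MI S hSclosed hSne
    (by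
      intro g hg i j x y h
      have key := hglue (IccExtend h1n.le g) ((hext g _ x₁.2).trans hg.1)
        ((hext g _ xₙ.2).trans hg.2)
      have h' : L i x = L j y := congrArg Subtype.val h
      rcases le_total i.1 j.1 with hij | hij
      · have := key i j i.2.1 hij j.2.2 x x.2 y y.2 h'
        rwa [hext g _ x.2, hext g _ y.2] at this
      · have := key j i j.2.1 hij i.2.2 y y.2 x x.2 h'.symm
        rw [hext g _ x.2, hext g _ y.2] at this
        exact this.symm)
    (by
      intro g hg h hh
      have key := hdata (IccExtend h1n.le g) (IccExtend h1n.le h) ((hext g _ x₁.2).trans hg.1)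
        ((hext g _ xₙ.2).trans hg.2) (by
          intro j h1 h2 s hs
          rw [hext g s hs, hext h _ (hLsub j h1 h2 s hs)]
          exact hh ⟨j, h1, h2⟩ ⟨s, hs⟩)
      exact ⟨(hext h _ x₁.2).symm.trans (key 1 le_rfl (by omega)),
        (hext h _ xₙ.2).symm.trans (key n (by omega) le_rfl)⟩)
  have hφ1 := (hext φ _ x₁.2).trans hφS.1
  have hφn := (hext φ _ xₙ.2).trans hφS.2
  have hφeq : ∀ j, 1 ≤ j → j ≤ n - 1 → ∀ s ∈ Icc (t 1) (t n),
      IccExtend h1n.le φ (L j s) = lam j * IccExtend h1n.le φ s + M j s := by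
    intro j h1 h2 s hs
    rw [hext φ s hs, hext φ _ (hLsub j h1 h2 s hs)]
    exact hφ ⟨j, h1, h2⟩ ⟨s, hs⟩
  refine ⟨IccExtend h1n.le φ, ⟨φ.continuous.Icc_extend'.continuousOn, hφ1, hφn, hφeq⟩, ?_,
    hdata _ _ hφ1 hφn hφeq⟩
  rintro ψ ⟨hψc, -, -, hψ⟩ x hx
  let ψI : C(I, ℝ) := ⟨fun s => ψ s, hψc.domRestrict⟩
  have hψφ : ψI = φ := selfReferential_unique (L := fun j => LI j) hsurj
    (fun j : ι => hlam j j.2.1 j.2.2) hφ (fun j s => hψ j j.2.1 j.2.2 s s.2)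
  rw [hext φ x hx, ← hψφ]
  rfl
end

section
/- Let t_1 < ... < t_n (n ≥ 3) be real numbers with strictly positive data f_1, ..., f_n > 0 and derivative values d_1, ..., d_n ∈ ℝ; let ε ∈ {0,1}^{n−1} be a signature, l = t_n − t_1, a_j = (t_{j+1−ε_j} − t_{j+ε_j})/(t_n − t_1). Fix j ∈ {1, ..., n−1} and suppose 0 ≤ λ_j < min{f_{j+ε_j}/f_1, f_{j+1−ε_j}/f_n}. Set f_j* = f_{j+ε_j} − λ_j f_1, f_{j+1}* = f_{j+1−ε_j} − λ_j f_n, d_j* = a_j d_{j+ε_j} − λ_j d_1, d_{j+1}* = a_j d_{j+1−ε_j} − λ_j d_n. Suppose the shape parameters satisfy α_j > 0, δ_j > 0, β_j > max{0, −2lα_j d_j*/(π f_j*)}, and γ_j > max{0, 2lδ_j d_{j+1}*/(π f_{j+1}*)}. Then the four coefficients U_j = α_j f_j*, V_j = β_j f_j* + (2lα_j/π) d_j*, W_j = γ_j f_{j+1}* − (2lδ_j/π) d_{j+1}*, and X_j = δ_j f_{j+1}* are all strictly positive, and consequently p_j(θ) = (1 − sin θ)^3 U_j + sin θ(1 − sin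 θ)^2 V_j + cos θ(1 − cos θ)^2 W_j + (1 − cos θ)^3 X_j > 0 for every θ ∈ [0, π/2]. -/
open Set Real

/-- Under the positivity constraints on the scaling factor and the
shape parameters, the four numerator coefficients `U j, V j, W j, X j` of the
rational cubic trigonometric function on the `j`-th subinterval are strictly
positive, and hence the numerator `p j` is strictly positive on `[0, π/2]`. -/
theorem RCTZFIF_numerator_coefficients_pos
    (n : ℕ) (hn : 3 ≤ n)
    (t f d : ℕ → ℝ)
    (ht : ∀ i, 1 ≤ i → i ≤ n - 1 → t i < t (i + 1))
    (hf : ∀ i, 1 ≤ i → i ≤ n → 0 < f i)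
    (ε : ℕ → ℕ) (hε : ∀ j, 1 ≤ j → j ≤ n - 1 → ε j = 0 ∨ ε j = 1)
    (l : ℝ) (hl : l = t n - t 1)
    (a : ℕ → ℝ)
    (ha : ∀ j, 1 ≤ j → j ≤ n - 1 →
      a j = (t (j + 1 - ε j) - t (j + ε j)) / (t n - t 1))
    (j : ℕ) (hj1 : 1 ≤ j) (hj2 : j ≤ n - 1)
    (lam : ℝ) (hlam0 : 0 ≤ lam)
    (hlam : lam < min (f (j + ε j) / f 1) (f (j + 1 - ε j) / f n))
    (fs fss ds dss : ℝ)
    (hfs : fs = f (j + ε j) - lam * f 1)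
    (hfss : fss = f (j + 1 - ε j) - lam * f n)
    (hds : ds = a j * d (j + ε j) - lam * d 1)
    (hdss : dss = a j * d (j + 1 - ε j) - lam * d n)
    (α β γ δ : ℝ)
    (hα : 0 < α) (hδ : 0 < δ)
    (hβ : β > max 0 (-(2 * l * α * ds) / (π * fs)))
    (hγ : γ > max 0 ((2 * l * δ * dss) / (π * fss)))
    (U V W X : ℝ)
    (hU : U = α * fs)
    (hV : V = β * fs + (2 * l * α / π) * ds)
    (hW : W = γ * fss - (2 * l * δ / π) * dss)
    (hX : X = δ * fss)
    (p : ℝ → ℝ)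
    (hp : ∀ θ : ℝ, p θ = (1 - sin θ) ^ 3 * U + sin θ * (1 - sin θ) ^ 2 * V +
      cos θ * (1 - cos θ) ^ 2 * W + (1 - cos θ) ^ 3 * X) :
    0 < U ∧ 0 < V ∧ 0 < W ∧ 0 < X ∧
      ∀ θ ∈ Icc (0 : ℝ) (π / 2), 0 < p θ := by
  have hf1 : 0 < f 1 := hf 1 le_rfl (by omega)
  have hfn : 0 < f n := hf n (by omega) le_rfl
  have hfs_pos : 0 < fs := by
    have h := (lt_div_iff₀ hf1).1 (hlam.trans_le (min_le_left _ _))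
    linarith
  have hfss_pos : 0 < fss := by
    have h := (lt_div_iff₀ hfn).1 (hlam.trans_le (min_le_right _ _))
    linarith
  have hU_pos : 0 < U := hU ▸ mul_pos hα hfs_pos
  have hX_pos : 0 < X := hX ▸ mul_pos hδ hfss_pos
  have hV_pos : 0 < V := by
    have h := mul_lt_mul_of_pos_right ((le_max_right _ _).trans_lt hβ) hfs_pos
    have e : -(2 * l * α * ds) / (π * fs) * fs = -((2 * l * α / π) * ds) := by
      field_simp
    linarith
  have hW_pos : 0 < W := by
    have h := mul_lt_mul_of_pos_right ((le_max_right _ _).trans_lt hγ) hfss_pos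
    have e : (2 * l * δ * dss) / (π * fss) * fss = (2 * l * δ / π) * dss := by
      field_simp
    linarith
  refine ⟨hU_pos, hV_pos, hW_pos, hX_pos, fun θ hθ => ?_⟩
  rw [hp]
  have hs : 0 ≤ sin θ := sin_nonneg_of_nonneg_of_le_pi hθ.1 (by linarith [hθ.2, pi_pos])
  have hc : 0 ≤ cos θ := cos_nonneg_of_neg_pi_div_two_le_of_le (by linarith [hθ.1, pi_pos]) hθ.2
  have hs' : 0 ≤ 1 - sin θ := sub_nonneg.2 (sin_le_one θ)
  have hc' : 0 ≤ 1 - cos θ := sub_nonneg.2 (cos_le_one θ)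
  rcases hs'.eq_or_lt with h | h
  · have hcos : cos θ = 0 := by
      have hsin : sin θ = 1 := by linarith
      simpa [hsin] using sin_sq_add_cos_sq θ
    simpa [← h, hcos] using hX_pos
  · positivity
end
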